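/- Let λ > 1, W > 0 and 0 < α < 1. Suppose ψ : closure(Π) → ℝ is twice continuously differentiable, ψ and all its partial derivatives up to order two are bounded and uniformly continuous on closure(Π) with the second-order derivatives Hölder continuous of exponent α, ψ > 0 in Π, and ψ satisfies −Δψ + ψ = λ(ψ − W x₂)₊ pointwise in Π, ψ = 0 on ∂Π, and ψ(x) → 0 as |x| → ∞. Then there exists c ∈ ℝ such that ψ(x) = Ψ_L^{λ,W}(x + c e₁) for all x ∈ closure(Π), where e₁ = (1,0). -/

import Mathlib

open MeasureTheory Real Filter

noncomputable section

/-- The upper half plane `Π = {x ∈ ℝ² : x₂ > 0}`. -/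
def UHP : Set (ℝ × ℝ) := {x | 0 < x.2}

/-- Euclidean norm of a point of `ℝ²`. -/
def rad (x : ℝ × ℝ) : ℝ := Real.sqrt (x.1 ^ 2 + x.2 ^ 2)

/-- Modified Bessel function of the second kind of order `0`:
`K₀(r) = ∫₀^∞ exp(-r cosh t) dt`. -/
def K0 (r : ℝ) : ℝ := ∫ t in Set.Ioi (0 : ℝ), Real.exp (-(r * Real.cosh t))

/-- Fundamental solution `G(x,y) = (1/2π) K₀(|x-y|)` of `−Δ + Id` on `ℝ²`. -/
def Gker (x y : ℝ × ℝ) : ℝ := (1 / (2 * Real.pi)) * K0 (rad (x - y))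

/-- Reflection `x̄ = (x₁, −x₂)` across the `x₁`-axis. -/
def reflPt (x : ℝ × ℝ) : ℝ × ℝ := (x.1, -x.2)

/-- Green's function `G_Π(x,y) = G(x,y) − G(x̄,y)` of `−Δ + Id` on the half plane. -/
def GUHP (x y : ℝ × ℝ) : ℝ := Gker x y - Gker (reflPt x) y

/-- The operator `𝒢ω(x) = ∫_Π G_Π(x,y) ω(y) dy`. -/
def Gop (ω : ℝ × ℝ → ℝ) (x : ℝ × ℝ) : ℝ := ∫ y in UHP, GUHP x y * ω y

/-- Kinetic energy `E(ω) = (1/2) ∫_Π ω 𝒢ω`. -/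
def kineticE (ω : ℝ × ℝ → ℝ) : ℝ := (1 / 2) * ∫ x in UHP, ω x * Gop ω x

/-- Impulse `I(ω) = ∫_Π x₂ ω dx`. -/
def impulse (ω : ℝ × ℝ → ℝ) : ℝ := ∫ x in UHP, x.2 * ω x

/-- `L¹(Π)` norm. -/
def normL1 (f : ℝ × ℝ → ℝ) : ℝ := ∫ x in UHP, |f x|

/-- `L²(Π)` norm. -/
def normL2 (f : ℝ × ℝ → ℝ) : ℝ := (∫ x in UHP, (f x) ^ 2) ^ ((1 : ℝ) / 2)

/-- `L^s(Π)` norm. -/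
def normLs (s : ℝ) (f : ℝ × ℝ → ℝ) : ℝ := (∫ x in UHP, |f x| ^ s) ^ (1 / s)

/-- Nonnegative member of `L¹(Π) ∩ L²(Π)`. -/
def NonnegL1L2 (ω : ℝ × ℝ → ℝ) : Prop :=
  (∀ x ∈ UHP, 0 ≤ ω x) ∧ IntegrableOn ω UHP ∧ IntegrableOn (fun x => (ω x) ^ 2) UHP

/-- Steiner symmetry in the `x₁` variable. -/
def SteinerSym (f : ℝ × ℝ → ℝ) : Prop :=
  (∀ x : ℝ × ℝ, f (-x.1, x.2) = f x) ∧
  ∀ x₂ : ℝ, 0 < x₂ → AntitoneOn (fun x₁ => f (x₁, x₂)) (Set.Ioi (0 : ℝ))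

/-- The admissible class `𝒜_{μ,ν}`. -/
def InAdm (μ ν : ℝ) (ω : ℝ × ℝ → ℝ) : Prop :=
  (∀ x ∈ UHP, 0 ≤ ω x) ∧ IntegrableOn ω UHP ∧ IntegrableOn (fun x => (ω x) ^ 2) UHP ∧
  IntegrableOn (fun x => x.2 * ω x) UHP ∧
  impulse ω = μ ∧ (∫ x in UHP, ω x) ≤ ν

/-- The energy functional `ℰ_λ(ω) = E(ω) − (1/(2λ)) ∫_Π ω²`. -/
def Efun (lam : ℝ) (ω : ℝ × ℝ → ℝ) : ℝ :=
  kineticE ω - (1 / (2 * lam)) * ∫ x in UHP, (ω x) ^ 2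

/-- The supremum `S_{μ,ν,λ} = sup_{ω ∈ 𝒜_{μ,ν}} ℰ_λ(ω)`. -/
def Sval (lam μ ν : ℝ) : ℝ := sSup {s | ∃ ω, InAdm μ ν ω ∧ s = Efun lam ω}

/-- `ω` is a maximizer, i.e. `ω ∈ Σ_{μ,ν,λ}`. -/
def IsMaximizer (lam μ ν : ℝ) (ω : ℝ × ℝ → ℝ) : Prop :=
  InAdm μ ν ω ∧ Efun lam ω = Sval lam μ ν

/-- Bessel function of the first kind of order one. -/
def J1 (r : ℝ) : ℝ :=
  ∑' k : ℕ, ((-1 : ℝ) ^ k / ((Nat.factorial k : ℝ) * (Nat.factorial (k + 1) : ℝ))) *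
    (r / 2) ^ (2 * k + 1)

/-- Modified Bessel function of the second kind of order one. -/
def K1 (r : ℝ) : ℝ := ∫ t in Set.Ioi (0 : ℝ), Real.exp (-(r * Real.cosh t)) * Real.cosh t

/-- The set of `t > 0` with `J₁(√(λ−1) t) ≠ 0` solving the transcendental equation
`t (K₁'(t)/K₁(t) + (λ−1)^{-1/2} J₁'(√(λ−1)t)/J₁(√(λ−1)t)) = λ/(λ−1)`. -/
def aSet (lam : ℝ) : Set ℝ :=
  {t | 0 < t ∧ J1 (Real.sqrt (lam - 1) * t) ≠ 0 ∧
    t * (deriv K1 t / K1 t +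
      (1 / Real.sqrt (lam - 1)) *
        (deriv J1 (Real.sqrt (lam - 1) * t) / J1 (Real.sqrt (lam - 1) * t))) = lam / (lam - 1)}

/-- The smallest positive solution `a = a(λ)`. -/
def aLam (lam : ℝ) : ℝ := sInf (aSet lam)

/-- The stream function `Ψ_L^{λ,W}` of the Lamb dipole, written in polar coordinates
`x₁ = r cos θ`, `x₂ = r sin θ` (so that `sin θ = x₂ / r`). -/
def PsiL (lam W : ℝ) (x : ℝ × ℝ) : ℝ :=
  if rad x ≤ aLam lam then
    ((-(W * aLam lam / (lam - 1)) / J1 (Real.sqrt (lam - 1) * aLam lam)) *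
        J1 (Real.sqrt (lam - 1) * rad x) + (W * lam / (lam - 1)) * rad x) * (x.2 / rad x)
  else (W * aLam lam / K1 (aLam lam)) * K1 (rad x) * (x.2 / rad x)

/-- The Lamb dipole `ω_L^{λ,W} = λ (Ψ_L^{λ,W} − W x₂)₊` restricted to `Π`. -/
def omegaL (lam W : ℝ) (x : ℝ × ℝ) : ℝ :=
  if 0 < x.2 then lam * max (PsiL lam W x - W * x.2) 0 else 0

/-- `ϱ(λ) = (∫_Π ω_L^{λ,1} dx) / I(ω_L^{λ,1})`. -/
def varrho (lam : ℝ) : ℝ := (∫ x in UHP, omegaL lam 1 x) / impulse (omegaL lam 1)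

/-- The Laplacian on `ℝ²`, written coordinatewise. -/
def lap (ψ : ℝ × ℝ → ℝ) (x : ℝ × ℝ) : ℝ :=
  deriv (deriv fun t => ψ (t, x.2)) x.1 + deriv (deriv fun t => ψ (x.1, t)) x.2

/-- Distance (in `L¹ ∩ L²` plus weighted `L¹`) from `ζ` to a set of functions `S`. -/
def distToSet (S : Set ((ℝ × ℝ) → ℝ)) (ζ : (ℝ × ℝ) → ℝ) : ℝ :=
  sInf {d | ∃ ω ∈ S, d = normL1 (fun x => ζ x - ω x) + normL2 (fun x => ζ x - ω x) +
    normL1 (fun x => x.2 * (ζ x - ω x))}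

end

section
open Topology InnerProductSpace Laplacian


lemma deriv2_of {h h' : ℝ → ℝ} {t₀ c : ℝ} (h1 : ∀ᶠ t in 𝓝 t₀, HasDerivAt h (h' t) t)
    (h2 : HasDerivAt h' c t₀) : deriv (deriv h) t₀ = c := by
  have : deriv h =ᶠ[𝓝 t₀] h' := h1.mono fun t ht => ht.deriv
  rw [this.deriv_eq]; exact h2.deriv

lemma c2_hasDeriv {F : ℝ → ℝ} {r : ℝ} (hF : ContDiffAt ℝ 2 F r) :
    (∀ᶠ t in 𝓝 r, HasDerivAt F (deriv F t) t) ∧ HasDerivAt (deriv F) (deriv (deriv F) r) r := by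
  constructor
  · have := hF.eventually (by simp)
    filter_upwards [this] with t ht
    exact (ht.differentiableAt (by norm_num)).hasDerivAt
  · have h1 : ContDiffAt ℝ 1 (deriv F) r := by
      have h : ContDiffAt ℝ 1 (fderiv ℝ F) r := hF.fderiv_right (by norm_num)
      have : deriv F = fun t => fderiv ℝ F t 1 := by ext t; simp
      rw [this]
      exact h.clm_apply contDiffAt_const
    exact (h1.differentiableAt (by norm_num)).hasDerivAt

lemma line_comp (F : ℝ → ℝ) (q0 a b : ℝ) (hF : ContDiffAt ℝ 2 F q0) :
    deriv (deriv fun t : ℝ => F (q0 + t * a + t ^ 2 * b)) 0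
      = deriv (deriv F) q0 * a ^ 2 + 2 * b * deriv F q0 := by
  obtain ⟨h1, h2⟩ := c2_hasDeriv hF
  have hq : ∀ t : ℝ, HasDerivAt (fun t : ℝ => q0 + t * a + t ^ 2 * b) (a + 2 * t * b) t := by
    intro t
    have := (((hasDerivAt_id t).mul_const a).const_add q0).add (((hasDerivAt_pow 2 t)).mul_const b)
    exact this.congr_deriv (by simp)
  have hc : Tendsto (fun t : ℝ => q0 + t * a + t ^ 2 * b) (𝓝 0) (𝓝 q0) := by
    have : Continuous (fun t : ℝ => q0 + t * a + t ^ 2 * b) := by fun_prop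
    have := this.tendsto 0
    simpa using this
  refine deriv2_of (h' := fun t => deriv F (q0 + t * a + t ^ 2 * b) * (a + 2 * t * b)) ?_ ?_
  · filter_upwards [hc.eventually h1] with t ht
    exact ht.comp t (hq t)
  · have e0 : q0 + (0:ℝ) * a + (0:ℝ) ^ 2 * b = q0 := by ring
    have h3 : HasDerivAt (fun t : ℝ => deriv F (q0 + t * a + t ^ 2 * b))
        (deriv (deriv F) q0 * (a + 2 * 0 * b)) 0 := by
      apply HasDerivAt.comp (h₂ := deriv F) (0:ℝ) _ (hq 0)
      rw [e0]; exact h2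
    have h4 : HasDerivAt (fun t : ℝ => a + 2 * t * b) (2 * b) 0 := by
      have := (((hasDerivAt_id (0:ℝ)).const_mul 2).mul_const b).const_add a
      simpa using this
    have := h3.mul h4
    exact this.congr_deriv (by simp; ring)

section
variable {E : Type*} [NormedAddCommGroup E] [InnerProductSpace ℝ E] [FiniteDimensional ℝ E]
  {ι : Type*} [Fintype ι]

lemma iter2_line {f : E → ℝ} {x : E} (hf : ContDiffAt ℝ 2 f x) (v : E) :
    iteratedFDeriv ℝ 2 f x ![v, v] = deriv (deriv fun t : ℝ => f (x + t • v)) 0 := by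
  symm
  have hl : ∀ t : ℝ, HasDerivAt (fun t : ℝ => x + t • v) v t := by
    intro t
    have := ((hasDerivAt_id t).smul_const v).const_add x
    simpa using this
  have hc : Tendsto (fun t : ℝ => x + t • v) (𝓝 0) (𝓝 x) := by
    have : Continuous (fun t : ℝ => x + t • v) := by fun_prop
    have := this.tendsto 0
    simpa using this
  have e0 : x + (0:ℝ) • v = x := by simp
  refine deriv2_of (h' := fun t => fderiv ℝ f (x + t • v) v) ?_ ?_
  · have := hf.eventually (by simp)
    filter_upwards [hc.eventually this] with t ht
    exact (ht.differentiableAt (by norm_num)).hasFDerivAt.comp_hasDerivAt t (hl t)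
  · have h : ContDiffAt ℝ 1 (fderiv ℝ f) x := hf.fderiv_right (by norm_num)
    have h2 := (h.differentiableAt (by norm_num)).hasFDerivAt
    rw [← e0] at h2
    have h3 := h2.comp_hasDerivAt (0:ℝ) (hl 0)
    have h4 := h3.clm_apply (hasDerivAt_const (0:ℝ) v)
    refine h4.congr_deriv ?_
    rw [iteratedFDeriv_two_apply]
    simp

lemma lap_line {f : E → ℝ} {x : E} (hf : ContDiffAt ℝ 2 f x) (b : OrthonormalBasis ι ℝ E) :
    Δ f x = ∑ i, deriv (deriv fun t : ℝ => f (x + t • b i)) 0 := by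
  rw [laplacian_eq_iteratedFDeriv_orthonormalBasis f b]
  exact Finset.sum_congr rfl fun i _ => iter2_line hf _

lemma lap_comp (F : ℝ → ℝ) (q : E → ℝ) (x : E) (hq : ContDiff ℝ 2 q)
    (v : OrthonormalBasis ι ℝ E) (a b : ι → ℝ)
    (h : ∀ i (t : ℝ), q (x + t • v i) = q x + t * a i + t ^ 2 * b i)
    (hF : ContDiffAt ℝ 2 F (q x)) :
    Δ (fun y => F (q y)) x
      = deriv (deriv F) (q x) * ∑ i, a i ^ 2 + 2 * (∑ i, b i) * deriv F (q x) := by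
  have hc : ContDiffAt ℝ 2 (fun y => F (q y)) x := hF.comp x hq.contDiffAt
  rw [lap_line hc v]
  simp only [h, line_comp F _ _ _ hF]
  rw [Finset.sum_add_distrib, ← Finset.mul_sum, ← Finset.sum_mul, ← Finset.mul_sum]

/-- second derivative is nonnegative at a local min -/
lemma deriv2_nonneg {h : ℝ → ℝ} {t₀ : ℝ} (hm : IsLocalMin h t₀) (hc : ContinuousAt h t₀) :
    0 ≤ deriv (deriv h) t₀ := by
  by_contra hneg
  push Not at hneg
  have hd : deriv h t₀ = 0 := hm.deriv_eq_zero
  have hM := isLocalMax_of_deriv_deriv_neg hneg hd hc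
  have : h =ᶠ[𝓝 t₀] fun _ => h t₀ := by
    filter_upwards [hm, hM] with t h1 h2
    exact le_antisymm h2 h1
  have h2 : deriv h =ᶠ[𝓝 t₀] deriv (fun _ => h t₀) := this.deriv
  have h3 := h2.deriv_eq
  simp at h3
  linarith

lemma lap_nonneg_of_min {f : E → ℝ} {x : E} (hf : ContDiffAt ℝ 2 f x) (hm : IsLocalMin f x) :
    0 ≤ Δ f x := by
  rw [lap_line hf (stdOrthonormalBasis ℝ E)]
  refine Finset.sum_nonneg fun i _ => ?_
  set v := stdOrthonormalBasis ℝ E i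
  have hcl : Continuous (fun t : ℝ => x + t • v) := by fun_prop
  have hc : Tendsto (fun t : ℝ => x + t • v) (𝓝 0) (𝓝 x) := by
    have := hcl.tendsto 0
    simpa using this
  apply deriv2_nonneg
  · have := hc.eventually hm
    unfold IsLocalMin IsMinFilter
    simpa using this
  · have : ContinuousAt f (x + (0:ℝ) • v) := by simpa using hf.continuousAt
    exact ContinuousAt.comp (f := fun t : ℝ => x + t • v) this hcl.continuousAt

/-- affine isometry change of variables -/
lemma lap_isom {f : E → ℝ} {x : E} (L : E ≃ₗᵢ[ℝ] E) (c : E) (hf : ContDiffAt ℝ 2 f (L x + c)) :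
    Δ (fun y => f (L y + c)) x = Δ f (L x + c) := by
  have hc : ContDiffAt ℝ 2 (fun y => f (L y + c)) x := by
    refine ContDiffAt.comp (g := f) (f := fun y => L y + c) x hf ?_
    exact (L.toContinuousLinearEquiv.contDiff.add contDiff_const).contDiffAt
  rw [lap_line hc (stdOrthonormalBasis ℝ E), lap_line hf ((stdOrthonormalBasis ℝ E).map L)]
  refine Finset.sum_congr rfl fun i _ => ?_
  congr 2
  ext t
  simp [add_right_comm]
end


abbrev E4 := EuclideanSpace ℝ (Fin 4)

def rho2 (x : E4) : ℝ := x 1 ^ 2 + x 2 ^ 2 + x 3 ^ 2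

lemma rho2_nonneg (x : E4) : 0 ≤ rho2 x := by unfold rho2; positivity

lemma rho2_contDiff : ContDiff ℝ 2 rho2 := by
  unfold rho2; fun_prop

lemma rho2_cont : Continuous rho2 := rho2_contDiff.continuous

/-- reflection in the hyperplane `⟪x,e⟫ = s` -/
noncomputable def Rf (e : E4) (s : ℝ) (x : E4) : E4 := x - (2 * (inner ℝ x e - s)) • e

lemma Rf_eq {e : E4} (he : ‖e‖ = 1) (s : ℝ) (x : E4) :
    Rf e s x = (ℝ ∙ e)ᗮ.reflection x + (2 * s) • e := by
  rw [Submodule.reflection_orthogonal_apply, Submodule.reflection_singleton_apply, Rf, he]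
  rw [real_inner_comm]
  simp
  module

lemma Rf_inner {e : E4} (he : ‖e‖ = 1) (s : ℝ) (x : E4) :
    inner ℝ (Rf e s x) e = 2 * s - inner ℝ x e := by
  rw [Rf, inner_sub_left, inner_smul_left, real_inner_self_eq_norm_sq, he]
  simp; ring

lemma Rf_Rf {e : E4} (he : ‖e‖ = 1) (s : ℝ) (x : E4) : Rf e s (Rf e s x) = x := by
  conv_lhs => rw [Rf]
  rw [Rf_inner he, Rf]
  module

lemma Rf_cont2 (e : E4) : Continuous (fun p : ℝ × E4 => Rf e p.1 p.2) := by
  unfold Rf; fun_prop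

lemma Rf_cont (e : E4) (s : ℝ) : Continuous (Rf e s) := by
  unfold Rf; fun_prop

lemma contDiff_inner_e (e : E4) : ContDiff ℝ 2 (fun y : E4 => (inner ℝ y e : ℝ)) :=
  contDiff_id.inner ℝ contDiff_const

lemma Rf_contDiff (e : E4) (s : ℝ) : ContDiff ℝ 2 (Rf e s) := by
  unfold Rf
  have := contDiff_inner_e e
  fun_prop

lemma Rf_plane {e x : E4} {s : ℝ} (h : inner ℝ x e = s) : Rf e s x = x := by
  simp [Rf, h]

lemma lap_Rf {f : E4 → ℝ} {e : E4} (he : ‖e‖ = 1) (s : ℝ) (x : E4)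
    (hf : ContDiffAt ℝ 2 f (Rf e s x)) : Δ (fun y => f (Rf e s y)) x = Δ f (Rf e s x) := by
  have := lap_isom (f := f) (x := x) ((ℝ ∙ e)ᗮ.reflection) ((2 * s) • e) (by
    rw [← Rf_eq he]; exact hf)
  simpa only [← Rf_eq he] using this

lemma lap_dist (F : ℝ → ℝ) (c x : E4) (hF : ContDiffAt ℝ 2 F (‖x - c‖ ^ 2)) :
    Δ (fun y : E4 => F (‖y - c‖ ^ 2)) x
      = 4 * ‖x - c‖ ^ 2 * deriv (deriv F) (‖x - c‖ ^ 2) + 8 * deriv F (‖x - c‖ ^ 2) := by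
  have hq : ContDiff ℝ 2 (fun y : E4 => ‖y - c‖ ^ 2) :=
    (contDiff_id.sub contDiff_const).norm_sq ℝ
  set v := EuclideanSpace.basisFun (Fin 4) ℝ
  rw [lap_comp F (fun y : E4 => ‖y - c‖ ^ 2) x hq v
    (fun i => 2 * inner ℝ (x - c) (v i)) (fun i => 1) ?_ hF]
  · have : ∑ i, (2 * inner ℝ (x - c) (v i)) ^ 2 = 4 * ‖x - c‖ ^ 2 := by
      rw [← v.sum_sq_inner_left (x - c), Finset.mul_sum]
      exact Finset.sum_congr rfl fun i _ => by ring
    rw [this]; simp; ring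
  · intro i t
    have h1 : x + t • v i - c = (x - c) + t • v i := by abel
    simp only [h1]
    rw [norm_add_sq_real, inner_smul_right, norm_smul, v.norm_eq_one]
    simp; ring

lemma lap_lin (F : ℝ → ℝ) {e : E4} (he : ‖e‖ = 1) (s : ℝ) (x : E4)
    (hF : ContDiffAt ℝ 2 F (inner ℝ x e - s)) :
    Δ (fun y : E4 => F (inner ℝ y e - s)) x = deriv (deriv F) (inner ℝ x e - s) := by
  have hq : ContDiff ℝ 2 (fun y : E4 => (inner ℝ y e : ℝ) - s) :=
    (contDiff_inner_e e).sub contDiff_const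
  set v := EuclideanSpace.basisFun (Fin 4) ℝ
  rw [lap_comp F (fun y : E4 => (inner ℝ y e : ℝ) - s) x hq v
    (fun i => inner ℝ (v i) e) (fun i => 0) ?_ hF]
  · rw [v.sum_sq_inner_right e, he]; simp
  · intro i t
    simp only [inner_add_left, inner_smul_left]
    simp; ring

lemma lap_log_rho2 (x : E4) (hx : rho2 x ≠ 0) : 0 ≤ Δ (fun y : E4 => Real.log (rho2 y)) x := by
  set v := EuclideanSpace.basisFun (Fin 4) ℝ
  have hF : ContDiffAt ℝ 2 Real.log (rho2 x) := Real.contDiffAt_log.2 hx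
  rw [lap_comp Real.log rho2 x rho2_contDiff v
    ![0, 2 * x 1, 2 * x 2, 2 * x 3] ![0, 1, 1, 1] ?_ hF]
  · have h1 : deriv Real.log = fun x => x⁻¹ := by ext x; simp
    rw [h1, deriv_inv]
    simp only [Fin.sum_univ_four]
    have hpos : 0 < rho2 x := lt_of_le_of_ne (rho2_nonneg x) (Ne.symm hx)
    have : (-(rho2 x ^ 2)⁻¹ * (4 * rho2 x) + 6 * (rho2 x)⁻¹) = 2 * (rho2 x)⁻¹ := by
      field_simp; ring
    have h3 : 0 ≤ 2 * (rho2 x)⁻¹ := by positivity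
    rw [← this] at h3
    refine h3.trans (le_of_eq ?_)
    simp [rho2]; ring
  · intro i t
    fin_cases i <;> simp [rho2, v] <;> ring

/-- The barrier for the exceptional set. -/
noncomputable def bet (e : E4) (s : ℝ) (x : E4) : ℝ := rho2 x * rho2 (Rf e s x)

lemma bet_cont (e : E4) (s : ℝ) : Continuous (bet e s) :=
  rho2_cont.mul (rho2_cont.comp (Rf_cont e s))

lemma bet_nonneg (e : E4) (s : ℝ) (x : E4) : 0 ≤ bet e s x :=
  mul_nonneg (rho2_nonneg _) (rho2_nonneg _)

lemma bet_lap {e : E4} (he : ‖e‖ = 1) (s : ℝ) (x : E4) (hx : bet e s x ≠ 0) :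
    ContDiffAt ℝ 2 (fun y => Real.log (bet e s y)) x ∧
      0 ≤ Δ (fun y => Real.log (bet e s y)) x := by
  have hx1 : rho2 x ≠ 0 := left_ne_zero_of_mul hx
  have hx2 : rho2 (Rf e s x) ≠ 0 := right_ne_zero_of_mul hx
  have hR : ContDiff ℝ 2 (fun y => rho2 (Rf e s y)) := rho2_contDiff.comp (Rf_contDiff e s)
  have hd1 : ContDiffAt ℝ 2 (fun y => Real.log (rho2 y)) x := rho2_contDiff.contDiffAt.log hx1
  have hd1' : ContDiffAt ℝ 2 (fun y => Real.log (rho2 y)) (Rf e s x) :=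
    rho2_contDiff.contDiffAt.log hx2
  have hd2 : ContDiffAt ℝ 2 (fun y => Real.log (rho2 (Rf e s y))) x := hR.contDiffAt.log hx2
  refine ⟨?_, ?_⟩
  · exact (rho2_contDiff.mul hR).contDiffAt.log hx
  · have : (fun y => Real.log (bet e s y)) =ᶠ[𝓝 x]
        ((fun y => Real.log (rho2 y)) + fun y => Real.log (rho2 (Rf e s y))) := by
      filter_upwards [(bet_cont e s).continuousAt.eventually_ne hx] with y hy
      exact Real.log_mul (left_ne_zero_of_mul hy) (right_ne_zero_of_mul hy)
    rw [(laplacian_congr_nhds this).eq_of_nhds, hd1.laplacian_add hd2,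
      lap_Rf (f := fun y => Real.log (rho2 y)) he s x hd1']
    exact add_nonneg (lap_log_rho2 _ hx1) (lap_log_rho2 _ hx2)

lemma rho2_dense : Dense {x : E4 | rho2 x ≠ 0} := by
  intro x
  rw [Metric.mem_closure_iff]
  intro ε hε
  by_cases hx : rho2 x = 0
  · refine ⟨x + EuclideanSpace.single 1 (ε / 2), ?_, ?_⟩
    · unfold rho2 at hx
      have h1 : x 1 = 0 := by nlinarith [sq_nonneg (x 1), sq_nonneg (x 2), sq_nonneg (x 3)]
      change _ ≠ _; unfold rho2
      have : (0:ℝ) < (ε / 2) ^ 2 := by positivity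
      simp [h1]
      nlinarith [sq_nonneg (x 2), sq_nonneg (x 3)]
    · rw [dist_eq_norm]
      simp [abs_of_pos hε]
      exact hε
  · exact ⟨x, hx, by simpa using hε⟩

lemma bet_dense {e : E4} (he : ‖e‖ = 1) (s : ℝ) : Dense {x : E4 | bet e s x ≠ 0} := by
  have h1 : IsOpen {x : E4 | rho2 x ≠ 0} := isOpen_ne_fun rho2_cont continuous_const
  let R : E4 ≃ₜ E4 := ⟨⟨Rf e s, Rf e s, Rf_Rf he s, Rf_Rf he s⟩, Rf_cont e s, Rf_cont e s⟩
  have h3 : Dense (R ⁻¹' {x : E4 | rho2 x ≠ 0}) := by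
    have := rho2_dense.preimage (f := R) R.isOpenMap
    exact this
  have := rho2_dense.inter_of_isOpen_left h3 h1
  refine this.mono ?_
  rintro x ⟨h4, h5⟩
  exact mul_ne_zero h4 h5

lemma lap_add' {f g : E4 → ℝ} {x : E4} (hf : ContDiffAt ℝ 2 f x) (hg : ContDiffAt ℝ 2 g x) :
    Δ (fun y => f y + g y) x = Δ f x + Δ g x := hf.laplacian_add hg

lemma lap_sub' {f g : E4 → ℝ} {x : E4} (hf : ContDiffAt ℝ 2 f x) (hg : ContDiffAt ℝ 2 g x) :
    Δ (fun y => f y - g y) x = Δ f x - Δ g x := hf.laplacian_sub hg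

lemma lap_cmul' {f : E4 → ℝ} {x : E4} (c : ℝ) (hf : ContDiffAt ℝ 2 f x) :
    Δ (fun y => c * f y) x = c * Δ f x := laplacian_smul c hf

lemma lap_const' (c : ℝ) (x : E4) : Δ (fun _ : E4 => c) x = 0 := by
  rw [laplacian_const]; rfl


lemma rmp {e : E4} (he : ‖e‖ = 1) (s : ℝ) {u c : E4 → ℝ} {x₀ : E4} (hm : IsLocalMin u x₀)
    (hu : ∀ᶠ x in 𝓝 x₀, ContinuousAt u x ∧
      (bet e s x ≠ 0 → ContDiffAt ℝ 2 u x ∧ Δ u x ≤ c x))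
    (hc : ContinuousAt c x₀) (hc0 : c x₀ < 0) : False := by
  set k := -c x₀ / 2 with hk
  have hkpos : 0 < k := by rw [hk]; linarith
  have hck : ∀ᶠ x in 𝓝 x₀, c x < -k := hc.eventually_lt_const (by rw [hk]; linarith)
  obtain ⟨r, hr, hball⟩ := Metric.nhds_basis_closedBall.eventually_iff.1 (hm.and (hu.and hck))
  set η := k / 16 with hη
  have hηpos : 0 < η := by positivity
  set v : E4 → ℝ := fun x => u x + η * ‖x - x₀‖ ^ 2 with hv
  have hvc : ContinuousOn v (Metric.closedBall x₀ r) := by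
    intro x hx
    have h1 := (hball hx).2.1.1
    have h2 : ContinuousAt (fun x : E4 => η * ‖x - x₀‖ ^ 2) x := by fun_prop
    exact (h1.add h2).continuousWithinAt
  have hvm : ∀ x ∈ Metric.closedBall x₀ r, u x₀ + η * ‖x - x₀‖ ^ 2 ≤ v x := by
    intro x hx
    have := (hball hx).1
    simp only [hv]; linarith
  -- a good nearby point
  have hx0 : x₀ ∈ Metric.closedBall x₀ r := Metric.mem_closedBall_self hr.le
  have hcv : ContinuousAt v x₀ := hvc.continuousAt (Metric.closedBall_mem_nhds _ hr)
  have hv0 : v x₀ = u x₀ := by simp [hv]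
  have hev : ∀ᶠ x in 𝓝 x₀, v x < u x₀ + η * r ^ 2 / 2 ∧ x ∈ Metric.ball x₀ r :=
    (hcv.eventually_lt_const (by rw [hv0]; nlinarith [sq_pos_of_pos hr])).and
      (Metric.ball_mem_nhds _ hr)
  obtain ⟨p, hp, hpb⟩ := (bet_dense he s).inter_nhds_nonempty hev
  obtain ⟨⟨hpv, hpball⟩, hpb⟩ : (v p < u x₀ + η * r ^ 2 / 2 ∧ p ∈ Metric.ball x₀ r) ∧
    bet e s p ≠ 0 := by first | exact ⟨hp, hpb⟩ | exact ⟨hpb, hp⟩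
  have hpB : 0 < bet e s p := lt_of_le_of_ne (bet_nonneg e s p) (Ne.symm hpb)
  obtain ⟨B, hB⟩ := (isCompact_closedBall x₀ r).bddAbove_image (bet_cont e s).continuousOn
  have hB' : ∀ x ∈ Metric.closedBall x₀ r, bet e s x ≤ B := fun x hx => hB ⟨x, hx, rfl⟩
  have hpcb : p ∈ Metric.closedBall x₀ r := Metric.ball_subset_closedBall hpball
  have hBpos : 0 < B := hpB.trans_le (hB' p hpcb)
  set D := Real.log B - Real.log (bet e s p) with hD
  have hDnn : 0 ≤ D := by
    have := Real.log_le_log hpB (hB' p hpcb); simp only [hD]; linarith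
  set ε := η * r ^ 2 / (2 * (D + 1)) with hε
  have hεpos : 0 < ε := by positivity
  have hεD : ε * D < η * r ^ 2 / 2 := by
    have h1 : ε * (D + 1) = η * r ^ 2 / 2 := by rw [hε]; field_simp
    nlinarith
  set z : E4 → ℝ := fun x => v x + ε * (Real.log B - Real.log (bet e s x)) with hz
  have hzp : z p < u x₀ + η * r ^ 2 := by simp only [hz]; linarith
  set δ := min (bet e s p) (B * Real.exp (-(η * r ^ 2 / ε))) with hδ
  have hδpos : 0 < δ := lt_min hpB (by positivity)
  set K := Metric.closedBall x₀ r ∩ {x | δ ≤ bet e s x} with hKdef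
  have hK : IsCompact K :=
    (isCompact_closedBall x₀ r).inter_right (isClosed_le continuous_const (bet_cont e s))
  have hzc : ContinuousOn z K := by
    refine (hvc.mono Set.inter_subset_left).add (continuousOn_const.mul (continuousOn_const.sub ?_))
    refine (bet_cont e s).continuousOn.log ?_
    rintro x ⟨_, hx⟩
    have hx' : δ ≤ bet e s x := hx
    exact (hδpos.trans_le hx').ne'
  have hpK : p ∈ K := ⟨hpcb, (min_le_left _ _ : δ ≤ bet e s p)⟩
  obtain ⟨q, hqK, hq⟩ := hK.exists_isMinOn ⟨p, hpK⟩ hzc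
  have hqb : q ∈ Metric.closedBall x₀ r := hqK.1
  have hqδ : δ ≤ bet e s q := hqK.2
  have hqpos : 0 < bet e s q := hδpos.trans_le hqδ
  have hzq : z q < u x₀ + η * r ^ 2 := (hq hpK).trans_lt hzp
  have hlogq : 0 ≤ Real.log B - Real.log (bet e s q) := by
    have := Real.log_le_log hqpos (hB' q hqb); linarith
  have hq1 : q ∈ Metric.ball x₀ r := by
    by_contra hcon
    have h1 : r ≤ ‖q - x₀‖ := by
      rw [Metric.mem_ball, dist_eq_norm] at hcon; linarith
    have h2 := hvm q hqb
    have h3 : r ^ 2 ≤ ‖q - x₀‖ ^ 2 := by gcongr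
    have h4 : z q ≥ v q := by simp only [hz]; nlinarith
    nlinarith
  have hq2 : δ < bet e s q := by
    rcases eq_or_lt_of_le hqδ with h | h
    · exfalso
      have h1 : bet e s q ≤ B * Real.exp (-(η * r ^ 2 / ε)) := by rw [← h]; exact min_le_right _ _
      have h2 := Real.log_le_log hqpos h1
      rw [Real.log_mul hBpos.ne' (Real.exp_pos _).ne', Real.log_exp] at h2
      have h3 : η * r ^ 2 / ε ≤ Real.log B - Real.log (bet e s q) := by linarith
      have h4 : η * r ^ 2 ≤ ε * (Real.log B - Real.log (bet e s q)) := by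
        rw [div_le_iff₀ hεpos] at h3; linarith
      have h5 := hvm q hqb
      have h6 : 0 ≤ η * ‖q - x₀‖ ^ 2 := by positivity
      simp only [hz] at hzq
      linarith
    · exact h
  have hKn : K ∈ 𝓝 q := by
    have h1 : {x | δ < bet e s x} ∈ 𝓝 q :=
      (isOpen_lt continuous_const (bet_cont e s)).mem_nhds hq2
    filter_upwards [Metric.isOpen_ball.mem_nhds hq1, h1] with x h1 h2
    exact ⟨Metric.ball_subset_closedBall h1, le_of_lt h2⟩
  have hzmin : IsLocalMin z q := hq.isLocalMin hKn
  obtain ⟨hl1, hl2⟩ := bet_lap he s q hqpos.ne'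
  obtain ⟨hu1, hu2⟩ := (hball hqb).2.1.2 hqpos.ne'
  have hu3 := (hball hqb).2.2
  -- C^2 pieces
  have hP := lap_dist (fun t => η * t) x₀ q (by fun_prop)
  have hPd : deriv (fun t : ℝ => η * t) = fun _ => η := by
    ext t; simp
  rw [hPd] at hP
  have hP1 : ContDiffAt ℝ 2 (fun y : E4 => η * ‖y - x₀‖ ^ 2) q :=
    (contDiff_const.mul ((contDiff_id.sub contDiff_const).norm_sq ℝ)).contDiffAt
  have hL1 : ContDiffAt ℝ 2 (fun y => (-ε) * Real.log (bet e s y)) q := contDiffAt_const.mul hl1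
  have hC1 : ContDiffAt ℝ 2 (fun _ : E4 => ε * Real.log B) q := contDiffAt_const
  have hzeq : z = fun y => ((u y + η * ‖y - x₀‖ ^ 2) + (-ε) * Real.log (bet e s y))
      + ε * Real.log B := by
    ext y; simp [hz, hv]; ring
  have hz2 : ContDiffAt ℝ 2 z q := by rw [hzeq]; exact ((hu1.add hP1).add hL1).add hC1
  have hfin := lap_nonneg_of_min hz2 hzmin
  rw [hzeq, lap_add' ((hu1.add hP1).add hL1) hC1, lap_add' (hu1.add hP1) hL1,
    lap_add' hu1 hP1, lap_cmul' _ hl1, hP, lap_const'] at hfin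
  simp at hfin
  nlinarith


structure Sol (lam W : ℝ) (Φ : E4 → ℝ) : Prop where
  lam1 : 1 < lam
  W0 : 0 < W
  cont : Continuous Φ
  lim : Tendsto Φ (cocompact E4) (𝓝 0)
  c2 : ∀ x, rho2 x ≠ 0 → ContDiffAt ℝ 2 Φ x
  pde : ∀ x, rho2 x ≠ 0 → Δ Φ x = Φ x - lam * max (Φ x - W) 0

noncomputable def wf (Φ : E4 → ℝ) (e : E4) (s : ℝ) (x : E4) : ℝ := Φ (Rf e s x) - Φ x

section
variable {lam W : ℝ} {Φ : E4 → ℝ}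

lemma wf_cont2 (h : Sol lam W Φ) (e : E4) :
    Continuous (fun p : ℝ × E4 => wf Φ e p.1 p.2) :=
  (h.cont.comp (Rf_cont2 e)).sub (h.cont.comp continuous_snd)

lemma wf_cont (h : Sol lam W Φ) (e : E4) (s : ℝ) : Continuous (wf Φ e s) :=
  (h.cont.comp (Rf_cont e s)).sub h.cont

lemma wf_lim (h : Sol lam W Φ) {e : E4} (he : ‖e‖ = 1) (s : ℝ) :
    Tendsto (wf Φ e s) (cocompact E4) (𝓝 0) := by
  let R : E4 ≃ₜ E4 := ⟨⟨Rf e s, Rf e s, Rf_Rf he s, Rf_Rf he s⟩, Rf_cont e s, Rf_cont e s⟩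
  have h1 : Tendsto (Rf e s) (cocompact E4) (cocompact E4) :=
    R.isClosedEmbedding.tendsto_cocompact
  have := (h.lim.comp h1).sub h.lim
  rw [sub_zero] at this
  exact this

lemma wf_lap (h : Sol lam W Φ) {e : E4} (he : ‖e‖ = 1) (s : ℝ) (x : E4) (hx : bet e s x ≠ 0) :
    ContDiffAt ℝ 2 (wf Φ e s) x ∧ Δ (wf Φ e s) x =
      (Φ (Rf e s x) - lam * max (Φ (Rf e s x) - W) 0) - (Φ x - lam * max (Φ x - W) 0) := by
  have hx1 : rho2 x ≠ 0 := left_ne_zero_of_mul hx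
  have hx2 : rho2 (Rf e s x) ≠ 0 := right_ne_zero_of_mul hx
  have h1 := h.c2 x hx1
  have h2 := h.c2 _ hx2
  have h3 : ContDiffAt ℝ 2 (fun y => Φ (Rf e s y)) x :=
    ContDiffAt.comp (g := Φ) (f := Rf e s) x h2 (Rf_contDiff e s).contDiffAt
  refine ⟨h3.sub h1, ?_⟩
  unfold wf
  rw [lap_sub' h3 h1, lap_Rf he s x h2, h.pde _ hx1, h.pde _ hx2]

lemma wf_anti (e : E4) (he : ‖e‖ = 1) (s : ℝ) (x : E4) : wf Φ e s (Rf e s x) = - wf Φ e s x := by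
  unfold wf; rw [Rf_Rf he]; ring

noncomputable def dl (lam : ℝ) : ℝ := 1 / (6 * lam)

lemma lemA (h : Sol lam W Φ) {e : E4} (he : ‖e‖ = 1) (s : ℝ)
    (hK : ∀ x, s + dl lam ≤ inner ℝ x e → W ≤ Φ x → 0 ≤ wf Φ e s x) :
    ∀ x, s ≤ inner ℝ x e → 0 ≤ wf Φ e s x := by
  have hl := h.lam1
  set μ := 6 * lam with hμ
  have hμpos : 0 < μ := by positivity
  set G : ℝ → ℝ := fun t => 2 - Real.exp (-μ * t) with hG
  have hG1 : ∀ t, 0 ≤ t → 1 ≤ G t := by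
    intro t ht
    have : Real.exp (-μ * t) ≤ 1 := Real.exp_le_one_iff.2 (by nlinarith)
    simp only [hG]; linarith
  have hG2 : ∀ t, G t ≤ 2 := by
    intro t; have := Real.exp_pos (-μ * t); simp only [hG]; linarith
  have hGc : ContDiff ℝ 2 G := by
    simp only [hG]; fun_prop
  have hGd : ∀ t, deriv (deriv G) t = -μ ^ 2 * Real.exp (-μ * t) := by
    intro t
    have he1 : ∀ t, HasDerivAt (fun t : ℝ => Real.exp (-μ * t)) (Real.exp (-μ * t) * (-μ)) t := by
      intro t
      have := ((hasDerivAt_id t).const_mul (-μ)).exp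
      simpa using this
    refine deriv2_of (h' := fun t => -(Real.exp (-μ * t) * (-μ))) ?_ ?_
    · exact Eventually.of_forall fun t => (he1 t).const_sub 2
    · have := ((he1 t).mul_const (-μ)).neg
      exact this.congr_deriv (by ring)
  set q : E4 → ℝ := fun x => inner ℝ x e - s with hq
  have hqc : Continuous q := by simp only [hq]; fun_prop
  set w := wf Φ e s with hw
  have hwc : Continuous w := wf_cont h e s
  have hGq : Continuous (fun x => G (q x)) := hGc.continuous.comp hqc
  by_contra hcon
  push Not at hcon
  obtain ⟨x₁, hx₁, hwx₁⟩ := hcon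
  set H : Set E4 := {x | 0 ≤ q x} with hH
  have hHc : IsClosed H := isClosed_le continuous_const hqc
  have hGH : ∀ x ∈ H, 1 ≤ G (q x) := fun x hx => hG1 _ hx
  have hx₁H : x₁ ∈ H := by change 0 ≤ q x₁; simp only [hq]; linarith
  have hquo : ContinuousOn (fun x => w x / G (q x)) H := by
    refine hwc.continuousOn.div hGq.continuousOn ?_
    intro x hx; have := hGH x hx; positivity
  have hv1 : w x₁ / G (q x₁) < 0 := div_neg_of_neg_of_pos hwx₁ (by linarith [hGH x₁ hx₁H])
  obtain ⟨x₀, hx₀H, hx₀⟩ := hquo.exists_isMinOn' hHc hx₁H (by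
    have h1 : ∀ᶠ x in cocompact E4, w x₁ / G (q x₁) < w x :=
      (wf_lim h he s).eventually_const_lt hv1
    filter_upwards [h1.filter_mono inf_le_left, (mem_inf_of_right (mem_principal_self H))]
      with x h1 h2
    have h3 := hGH x h2
    rcases le_or_gt 0 (w x) with h4 | h4
    · have : 0 ≤ w x / G (q x) := div_nonneg h4 (by linarith)
      linarith
    · refine h1.le.trans ?_
      rw [le_div_iff₀ (by linarith)]
      nlinarith)
  set m := -(w x₀ / G (q x₀)) with hm
  have hmpos : 0 < m := by
    have : w x₀ / G (q x₀) ≤ w x₁ / G (q x₁) := hx₀ hx₁H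
    rw [hm]; linarith
  have hG0 : 0 < G (q x₀) := by linarith [hGH x₀ hx₀H]
  have hwx₀ : w x₀ = -m * G (q x₀) := by rw [hm]; field_simp
  have hwneg : w x₀ < 0 := by rw [hwx₀]; nlinarith
  have hq0 : 0 < q x₀ := by
    rcases eq_or_lt_of_le (show 0 ≤ q x₀ from hx₀H) with h0 | h0
    · exfalso
      have : inner ℝ x₀ e = s := by simp only [hq] at h0; linarith
      have : w x₀ = 0 := by simp [hw, wf, Rf_plane this]
      linarith
    · exact h0
  set u : E4 → ℝ := fun x => w x + m * G (q x) with hu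
  have humin : IsLocalMin u x₀ := by
    have : {x | 0 < q x} ∈ 𝓝 x₀ := (isOpen_lt continuous_const hqc).mem_nhds hq0
    filter_upwards [this] with x hx
    have hxH : x ∈ H := le_of_lt hx
    have h1 : w x₀ / G (q x₀) ≤ w x / G (q x) := hx₀ hxH
    have h2 := hGH x hxH
    rw [le_div_iff₀ (by linarith)] at h1
    simp only [hu]
    rw [hwx₀]; rw [hm]
    nlinarith
  have huc : Continuous u := hwc.add (continuous_const.mul hGq)
  have hlapu : ∀ x, bet e s x ≠ 0 → ContDiffAt ℝ 2 u x ∧ Δ u x =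
      ((Φ (Rf e s x) - lam * max (Φ (Rf e s x) - W) 0) - (Φ x - lam * max (Φ x - W) 0))
        + m * (-μ ^ 2 * Real.exp (-μ * q x)) := by
    intro x hx
    obtain ⟨h1, h2⟩ := wf_lap h he s x hx
    have h3 : ContDiffAt ℝ 2 (fun y => G (q y)) x :=
      (hGc.comp ((contDiff_inner_e e).sub contDiff_const)).contDiffAt
    have h4 : ContDiffAt ℝ 2 (fun y => m * G (q y)) x := contDiffAt_const.mul h3
    refine ⟨h1.add h4, ?_⟩
    simp only [hu]
    rw [lap_add' h1 h4, lap_cmul' _ h3, lap_lin G he s x hGc.contDiffAt, hGd, h2]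
  have hwev : ∀ᶠ x in 𝓝 x₀, w x < 0 := hwc.continuousAt.eventually_lt_const hwneg
  by_cases hcase : Φ x₀ < W
  · have hev : ∀ᶠ x in 𝓝 x₀, Φ x < W := h.cont.continuousAt.eventually_lt_const hcase
    refine rmp he s humin (c := w) ?_ hwc.continuousAt hwneg
    filter_upwards [hwev, hev] with x h1 h2
    refine ⟨huc.continuousAt, fun hb => ⟨(hlapu x hb).1, ?_⟩⟩
    rw [(hlapu x hb).2]
    have h3 : Φ (Rf e s x) - Φ x < 0 := h1
    rw [max_eq_right (by linarith), max_eq_right (by linarith)]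
    have h4 : w x = Φ (Rf e s x) - Φ x := rfl
    have h5 : 0 ≤ m * (μ ^ 2 * Real.exp (-μ * q x)) := by positivity
    rw [h4]; linarith
  · push Not at hcase
    have hqd : q x₀ < dl lam := by
      by_contra hc
      push Not at hc
      have := hK x₀ (by simp only [hq] at hc; linarith) hcase
      linarith
    refine rmp he s humin
      (c := fun x => (lam - 1) * (- w x) + m * (-μ ^ 2 * Real.exp (-μ * q x))) ?_ ?_ ?_
    · filter_upwards [hwev] with x h1
      refine ⟨huc.continuousAt, fun hb => ⟨(hlapu x hb).1, ?_⟩⟩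
      rw [(hlapu x hb).2]
      have h4 : w x = Φ (Rf e s x) - Φ x := rfl
      rw [h4] at h1 ⊢
      have h6 : max (Φ x - W) 0 - max (Φ (Rf e s x) - W) 0 ≤ Φ x - Φ (Rf e s x) := by
        rcases max_cases (Φ x - W) 0 with h7 | h7 <;>
        rcases max_cases (Φ (Rf e s x) - W) 0 with h8 | h8 <;> linarith
      nlinarith
    · have : Continuous (fun x => (lam - 1) * (- w x) + m * (-μ ^ 2 * Real.exp (-μ * q x))) := by
        fun_prop
      exact this.continuousAt
    · have h1 : Real.exp (-1) ≤ Real.exp (-μ * q x₀) := by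
        apply Real.exp_le_exp.2
        have : μ * dl lam = 1 := by unfold dl; rw [hμ]; field_simp
        nlinarith
      have h2 : (1/3 : ℝ) < Real.exp (-1) := by
        rw [Real.exp_neg, one_div]
        exact inv_strictAnti₀ (Real.exp_pos 1) (by linarith [Real.exp_one_lt_d9])
      have h3 := hG2 (q x₀)
      have hg : (lam - 1) * G (q x₀) - μ ^ 2 * Real.exp (-μ * q x₀) < 0 := by
        have h5 : μ ^ 2 * (1/3) < μ ^ 2 * Real.exp (-μ * q x₀) := by
          have : 0 < μ ^ 2 := by positivity
          nlinarith
        have h6 : (lam - 1) * G (q x₀) ≤ (lam - 1) * 2 := by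
          have : 0 < lam - 1 := by linarith
          nlinarith
        rw [hμ] at h5 ⊢
        nlinarith
      change (lam - 1) * (- w x₀) + m * (-μ ^ 2 * Real.exp (-μ * q x₀)) < 0
      rw [hwx₀]
      nlinarith
end


section
variable {lam W : ℝ} {Φ : E4 → ℝ}

lemma exp_alpha (r0 : ℝ) (hr0 : 0 < r0) :
    ∃ α : ℝ, 0 < α ∧ 1 ≤ 4 * α ^ 2 * r0 ^ 2 - 8 * α := by
  refine ⟨3 / r0 ^ 2 + 1 , by positivity, ?_⟩
  have h : r0 ^ 2 * (3 / r0 ^ 2) = 3 := by field_simp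
  set b := 3 / r0 ^ 2
  have hb : 0 < b := by positivity
  nlinarith [sq_nonneg r0, sq_nonneg b]

lemma ball_pos (h : Sol lam W Φ) {e : E4} (he : ‖e‖ = 1) (s : ℝ)
    (hw : ∀ x, s ≤ inner ℝ x e → 0 ≤ wf Φ e s x) (y : E4) (R : ℝ) (hR : 0 < R)
    (hball : ∀ x ∈ Metric.closedBall y R, s ≤ inner ℝ x e) (hy : 0 < wf Φ e s y) :
    ∀ x ∈ Metric.ball y R, 0 < wf Φ e s x := by
  have hl := h.lam1
  set w := wf Φ e s with hwdef
  have hwc : Continuous w := wf_cont h e s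
  -- small ball
  have hev : ∀ᶠ x in 𝓝 y, w y / 2 < w x := hwc.continuousAt.eventually_const_lt (by linarith)
  obtain ⟨r0, hr0, hr0b⟩ := Metric.nhds_basis_closedBall.eventually_iff.1 hev
  obtain ⟨α, hα, hα1⟩ := exp_alpha r0 hr0
  set c0 := w y / 2 with hc0
  have hc0pos : 0 < c0 := by rw [hc0]; linarith
  set F : ℝ → ℝ := fun t => Real.exp (-α * t) - Real.exp (-α * R ^ 2) with hF
  have hFc : ContDiff ℝ 2 F := by simp only [hF]; fun_prop
  have he1 : ∀ t, HasDerivAt (fun t : ℝ => Real.exp (-α * t)) (Real.exp (-α * t) * (-α)) t := by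
    intro t
    have := ((hasDerivAt_id t).const_mul (-α)).exp
    simpa using this
  have hF1 : ∀ t, deriv F t = Real.exp (-α * t) * (-α) := fun t => ((he1 t).sub_const _).deriv
  have hF2 : ∀ t, deriv (deriv F) t = α ^ 2 * Real.exp (-α * t) := by
    intro t
    refine deriv2_of (h' := fun t => (Real.exp (-α * t) * (-α))) ?_ ?_
    · exact Eventually.of_forall fun t => (he1 t).sub_const _
    · exact ((he1 t).mul_const (-α)).congr_deriv (by ring)
  set n : E4 → ℝ := fun x => ‖x - y‖ ^ 2 with hn
  have hnc : ContDiff ℝ 2 n := (contDiff_id.sub contDiff_const).norm_sq ℝ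
  set u : E4 → ℝ := fun x => w x - c0 * F (n x) with hu
  have huc : Continuous u := hwc.sub (continuous_const.mul (hFc.continuous.comp hnc.continuous))
  have hFle : ∀ x, F (n x) ≤ 1 := by
    intro x
    have h1 : Real.exp (-α * n x) ≤ 1 := Real.exp_le_one_iff.2 (by
      have : 0 ≤ n x := by simp only [hn]; positivity
      nlinarith)
    have := Real.exp_pos (-α * R ^ 2)
    simp only [hF]; linarith
  suffices hmain : ∀ x ∈ Metric.closedBall y R, 0 ≤ u x by
    intro x hx
    have h1 := hmain x (Metric.ball_subset_closedBall hx)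
    have h2 : 0 < F (n x) := by
      simp only [hF]
      rw [sub_pos]
      apply Real.exp_lt_exp.2
      rw [Metric.mem_ball, dist_eq_norm] at hx
      have : n x < R ^ 2 := by simp only [hn]; gcongr
      nlinarith
    simp only [hu] at h1
    nlinarith
  by_contra hcon
  push Not at hcon
  obtain ⟨x₁, hx₁, hux₁⟩ := hcon
  obtain ⟨x₀, hx₀, hmin⟩ := (isCompact_closedBall y R).exists_isMinOn ⟨x₁, hx₁⟩ huc.continuousOn
  have hu0 : u x₀ < 0 := lt_of_le_of_lt (hmin hx₁) hux₁
  have hx₀R : x₀ ∈ Metric.ball y R := by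
    by_contra hc
    have h1 : ‖x₀ - y‖ = R := by
      rw [Metric.mem_ball, dist_eq_norm, not_lt] at hc
      rw [Metric.mem_closedBall, dist_eq_norm] at hx₀
      linarith
    have h2 : F (n x₀) = 0 := by simp [hF, hn, h1]
    have h3 := hw x₀ (hball x₀ hx₀)
    simp only [hu, h2] at hu0
    linarith
  have hx₀r : r0 < ‖x₀ - y‖ := by
    by_contra hc
    push Not at hc
    have h1 : w y / 2 < w x₀ := hr0b (by rw [Metric.mem_closedBall, dist_eq_norm]; exact hc)
    have h2 := hFle x₀
    simp only [hu] at hu0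
    nlinarith
  have hloc : IsLocalMin u x₀ :=
    hmin.isLocalMin (Filter.mem_of_superset (Metric.isOpen_ball.mem_nhds hx₀R)
      Metric.ball_subset_closedBall)
  refine rmp he s hloc (c := u) ?_ huc.continuousAt hu0
  have hrev : ∀ᶠ x in 𝓝 x₀, r0 < ‖x - y‖ := by
    have : Continuous fun x : E4 => ‖x - y‖ := by fun_prop
    exact this.continuousAt.eventually_const_lt hx₀r
  filter_upwards [hrev, Metric.isOpen_ball.mem_nhds hx₀R] with x hx1 hx2
  refine ⟨huc.continuousAt, fun hb => ?_⟩
  obtain ⟨h1, h2⟩ := wf_lap h he s x hb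
  have h3 : ContDiffAt ℝ 2 (fun y => F (n y)) x := (hFc.comp hnc).contDiffAt
  have h4 : ContDiffAt ℝ 2 (fun y => c0 * F (n y)) x := contDiffAt_const.mul h3
  refine ⟨h1.sub h4, ?_⟩
  have h5 : Δ (fun y => F (n y)) x = _ := lap_dist F y x hFc.contDiffAt
  simp only [hu]
  rw [lap_sub' h1 h4, lap_cmul' _ h3, h5, hF2, hF1, h2]
  have hwx : w x = Φ (Rf e s x) - Φ x := rfl
  have hwx0 : 0 ≤ w x := hw x (hball x (Metric.ball_subset_closedBall hx2))
  have h6 : max (Φ x - W) 0 ≤ max (Φ (Rf e s x) - W) 0 :=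
    max_le_max (by linarith) le_rfl
  have h7 : F (n x) ≤ Real.exp (-α * n x) := by
    have := Real.exp_pos (-α * R ^ 2)
    simp only [hF]; linarith
  have h8 : r0 ^ 2 ≤ n x := by simp only [hn]; gcongr
  have h9 : Real.exp (-α * n x) ≤ 4 * n x * (α ^ 2 * Real.exp (-α * n x))
      + 8 * (Real.exp (-α * n x) * -α) := by
    have : 1 ≤ 4 * α ^ 2 * n x - 8 * α := by
      have : 0 < α ^ 2 := by positivity
      nlinarith
    nlinarith [Real.exp_pos (-α * n x)]
  have h10 : F (n x) ≤ 4 * n x * (α ^ 2 * Real.exp (-α * n x))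
      + 8 * (Real.exp (-α * n x) * -α) := h7.trans h9
  have h11 := mul_le_mul_of_nonneg_left h10 hc0pos.le
  have h12 := mul_le_mul_of_nonneg_left h6 (by linarith : 0 ≤ lam)
  simp only [hn] at h11 ⊢
  linarith

/-- inner product control on balls -/
lemma inner_ball {e x y : E4} (he : ‖e‖ = 1) {R s : ℝ} (hy : s + R ≤ inner ℝ y e)
    (hx : x ∈ Metric.closedBall y R) : s ≤ inner ℝ x e := by
  have h1 : |(inner ℝ (x - y) e : ℝ)| ≤ ‖x - y‖ * ‖e‖ := abs_real_inner_le_norm _ _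
  rw [he, mul_one, inner_sub_left] at h1
  rw [Metric.mem_closedBall, dist_eq_norm] at hx
  have := (abs_le.1 h1).1
  linarith

lemma lemB (h : Sol lam W Φ) {e : E4} (he : ‖e‖ = 1) (s : ℝ)
    (hw : ∀ x, s ≤ inner ℝ x e → 0 ≤ wf Φ e s x)
    (hne : ∃ x, s ≤ inner ℝ x e ∧ wf Φ e s x ≠ 0) :
    ∀ x, s < inner ℝ x e → 0 < wf Φ e s x := by
  set w := wf Φ e s with hwdef
  have hwc : Continuous w := wf_cont h e s
  set H : Set E4 := {x | s < inner ℝ x e} with hH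
  have hic : Continuous fun x : E4 => (inner ℝ x e : ℝ) := by fun_prop
  have hHo : IsOpen H := isOpen_lt continuous_const hic
  have hconv : Convex ℝ H := by
    intro x hx y hy a b ha hb hab
    change s < _
    rw [inner_add_left, inner_smul_left, inner_smul_left]
    simp only [conj_trivial]
    have hx' : s < inner ℝ x e := hx
    have hy' : s < inner ℝ y e := hy
    rcases eq_or_lt_of_le ha with h0 | h0
    · have : b = 1 := by linarith
      subst this; rw [← h0]; linarith
    · have : s = a * s + b * s := by rw [← add_mul, hab, one_mul]
      nlinarith
  obtain ⟨x₁, hx₁, hwx₁⟩ := hne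
  have hx₁pos : 0 < w x₁ := lt_of_le_of_ne (hw x₁ hx₁) (Ne.symm hwx₁)
  have hx₁H : x₁ ∈ H := by
    rcases eq_or_lt_of_le hx₁ with h0 | h0
    · exfalso; apply hwx₁; simp [hwdef, wf, Rf_plane h0.symm]
    · exact h0
  by_contra hcon
  push Not at hcon
  obtain ⟨x₂, hx₂, hwx₂⟩ := hcon
  have hO1 : IsOpen (H ∩ {x | 0 < w x}) := hHo.inter (isOpen_lt continuous_const hwc)
  have hO2 : IsOpen (H ∩ {x | w x ≤ 0}) := by
    rw [Metric.isOpen_iff]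
    rintro x ⟨hxH, hx0⟩
    have hxH' : s < inner ℝ x e := hxH
    have hx0' : w x ≤ 0 := hx0
    set d := inner ℝ x e - s with hd
    have hdpos : 0 < d := by rw [hd]; linarith
    refine ⟨d / 3, by positivity, fun z hz => ?_⟩
    have hzH : s + 2 * d / 3 ≤ inner ℝ z e :=
      inner_ball he (s := s + 2 * d / 3) (R := d / 3) (by rw [hd]; linarith) (Metric.ball_subset_closedBall hz)
    refine ⟨by change s < _; linarith, ?_⟩
    by_contra hc
    have hc' : 0 < w z := not_le.1 hc
    have := ball_pos h he s hw z (d / 2) (by positivity)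
      (fun x hx => inner_ball he (by linarith) hx) hc' x (by
        rw [Metric.mem_ball, dist_comm]
        rw [Metric.mem_ball] at hz
        linarith)
    exact absurd this (not_lt.2 hx0')
  have hpre := hconv.isPreconnected
  obtain ⟨z, _, hz1, hz2⟩ := hpre _ _ hO1 hO2 (by
    intro x hx
    rcases lt_or_ge 0 (w x) with h1 | h1
    · exact Or.inl ⟨hx, h1⟩
    · exact Or.inr ⟨hx, h1⟩) ⟨x₁, hx₁H, hx₁H, hx₁pos⟩ ⟨x₂, hx₂, hx₂, hwx₂⟩
  have a1 : 0 < w z := hz1.2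
  have a2 : w z ≤ 0 := hz2.2
  linarith

lemma compact_K (h : Sol lam W Φ) : IsCompact {x | W ≤ Φ x} := by
  have hcl : IsClosed {x | W ≤ Φ x} := isClosed_le continuous_const h.cont
  have h1 : ∀ᶠ x in cocompact E4, Φ x < W := h.lim.eventually_lt_const h.W0
  obtain ⟨K, hK, hKs⟩ := mem_cocompact.1 h1
  refine hK.of_isClosed_subset hcl fun x hx => ?_
  by_contra hc
  have h2 : Φ x < W := hKs hc
  exact absurd h2 (not_lt.2 hx)

lemma dl_pos (h : Sol lam W Φ) : 0 < dl lam := by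
  have := h.lam1
  unfold dl; positivity

lemma lemC (h : Sol lam W Φ) {e : E4} (he : ‖e‖ = 1) (s : ℝ)
    (hw : ∀ x, s ≤ inner ℝ x e → 0 ≤ wf Φ e s x)
    (hne : ∃ x, s ≤ inner ℝ x e ∧ wf Φ e s x ≠ 0) :
    ∃ ε > 0, ∀ s', s - ε < s' → s' ≤ s → ∀ x, s' ≤ inner ℝ x e → 0 ≤ wf Φ e s' x := by
  have hd := dl_pos h
  have hB := lemB h he s hw hne
  have hic : Continuous fun x : E4 => (inner ℝ x e : ℝ) := by fun_prop
  set K := {x | W ≤ Φ x} ∩ {x | s + dl lam / 2 ≤ inner ℝ x e} with hK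
  have hKc : IsCompact K := (compact_K h).inter_right (isClosed_le continuous_const hic)
  have hev : ∀ᶠ s' in 𝓝 s, ∀ x ∈ K, 0 < wf Φ e s' x := by
    apply hKc.eventually_forall_of_forall_eventually
    rintro x ⟨_, hx⟩
    have hx' : s + dl lam / 2 ≤ inner ℝ x e := hx
    have h1 := hB x (by linarith)
    exact (wf_cont2 h e).continuousAt.eventually_const_lt h1
  obtain ⟨ε, hε, hεb⟩ := Metric.eventually_nhds_iff.1 hev
  refine ⟨min ε (dl lam / 2), by positivity, fun s' h1 h2 => ?_⟩
  have h3 : min ε (dl lam / 2) ≤ ε := min_le_left _ _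
  have h4 : min ε (dl lam / 2) ≤ dl lam / 2 := min_le_right _ _
  apply lemA h he s'
  intro x hx hWx
  refine (hεb (y := s') ?_ x ⟨hWx, ?_⟩).le
  · rw [Real.dist_eq, abs_lt]; constructor <;> linarith
  · change s + dl lam / 2 ≤ _; linarith

lemma lemE (h : Sol lam W Φ) (hpos : ∃ x, 0 < Φ x) {e : E4} (he : ‖e‖ = 1) :
    ∃ s, (∀ x, Φ (Rf e s x) = Φ x) ∧
      ∀ s', s ≤ s' → ∀ x, s' ≤ inner ℝ x e → Φ x ≤ Φ (Rf e s' x) := by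
  have hd := dl_pos h
  set P : ℝ → Prop := fun s => ∀ x, s ≤ inner ℝ x e → 0 ≤ wf Φ e s x with hP
  have hic : Continuous fun x : E4 => (inner ℝ x e : ℝ) := by fun_prop
  obtain ⟨s1, hs1⟩ := (compact_K h).bddAbove_image hic.continuousOn
  have hstart : ∀ s, s1 ≤ s → P s := by
    intro s hs
    apply lemA h he s
    intro x hx hWx
    have : inner ℝ x e ≤ s1 := hs1 ⟨x, hWx, rfl⟩
    linarith
  set S : Set ℝ := {s | ∀ s', s ≤ s' → P s'} with hS
  have hS1 : s1 ∈ S := hstart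
  have hbdd : BddBelow S := by
    by_contra hnb
    have hall : ∀ s, P s := by
      intro s
      rw [not_bddBelow_iff] at hnb
      obtain ⟨t, ht, hts⟩ := hnb s
      exact ht s hts.le
    obtain ⟨x₀, hx₀⟩ := hpos
    -- along x₀ - t e, Φ is at least Φ x₀
    have hge : ∀ t : ℝ, 0 ≤ t → Φ x₀ ≤ Φ (x₀ - t • e) := by
      intro t ht
      have h1 := hall (inner ℝ x₀ e - t / 2) x₀ (by linarith)
      have h2 : Rf e (inner ℝ x₀ e - t / 2) x₀ = x₀ - t • e := by
        unfold Rf; congr 2; ring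
      rw [wf, h2] at h1
      linarith
    have hlim : Tendsto (fun t : ℝ => x₀ - t • e) atTop (cocompact E4) := by
      rw [← Metric.cobounded_eq_cocompact, ← comap_norm_atTop, tendsto_comap_iff]
      refine tendsto_atTop_mono (f := fun t : ℝ => t - ‖x₀‖) ?_
        (tendsto_atTop_add_const_right _ _ tendsto_id)
      intro t
      have h1 : ‖t • e‖ = |t| := by rw [norm_smul, he]; simp
      have h2 := norm_sub_norm_le (t • e) x₀
      rw [norm_sub_rev] at h2
      have := le_abs_self t
      simp only [Function.comp]
      linarith
    have h3 := ge_of_tendsto (h.lim.comp hlim) ((eventually_ge_atTop 0).mono hge)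
    linarith
  set s := sInf S with hs
  have hup : ∀ s', s < s' → P s' := by
    intro s' hs'
    obtain ⟨t, ht, hts⟩ := exists_lt_of_csInf_lt ⟨s1, hS1⟩ hs'
    exact ht s' hts.le
  have hPs : P s := by
    intro x hx
    rcases eq_or_lt_of_le hx with h0 | h0
    · simp [wf, Rf_plane h0.symm]
    · have hc : Continuous fun t => wf Φ e t x := (wf_cont2 h e).comp (by fun_prop : Continuous fun t : ℝ => (t, x))
      have : Tendsto (fun t => wf Φ e t x) (𝓝[>] s) (𝓝 (wf Φ e s x)) :=
        hc.continuousAt.tendsto.mono_left nhdsWithin_le_nhds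
      refine ge_of_tendsto this ?_
      have : Set.Ioo s (inner ℝ x e) ∈ 𝓝[>] s := Ioo_mem_nhdsGT h0
      filter_upwards [this] with t ht
      exact hup t ht.1 x ht.2.le
  have hPall : ∀ s', s ≤ s' → P s' := by
    intro s' hs'
    rcases eq_or_lt_of_le hs' with h0 | h0
    · rw [← h0]; exact hPs
    · exact hup s' h0
  have hzero : ∀ x, s ≤ inner ℝ x e → wf Φ e s x = 0 := by
    by_contra hcon
    push Not at hcon
    obtain ⟨ε, hε, hC⟩ := lemC h he s hPs hcon
    have hmem : s - ε / 2 ∈ S := by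
      intro s' hs'
      rcases le_or_gt s' s with h1 | h1
      · exact hC s' (by linarith) h1
      · exact hup s' h1
    have := csInf_le hbdd hmem
    linarith
  refine ⟨s, fun x => ?_, fun s' hs' x hx => ?_⟩
  · rcases le_total s (inner ℝ x e) with h1 | h1
    · have := hzero x h1
      rw [wf] at this; linarith
    · have := hzero (Rf e s x) (by rw [Rf_inner he]; linarith)
      rw [wf_anti e he, wf] at this; linarith
  · have := hPall s' hs' x hx
    rw [wf] at this; linarith
end


lemma lemF {lam W : ℝ} {Φ : E4 → ℝ} (h : Sol lam W Φ) (hpos : ∃ x, 0 < Φ x)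
    (hax : ∀ x y : E4, x 0 = y 0 → rho2 x = rho2 y → Φ x = Φ y) :
    ∃ c : ℝ, ∀ x y : E4, ‖x - EuclideanSpace.single 0 c‖ ≤ ‖y - EuclideanSpace.single 0 c‖ →
      Φ y ≤ Φ x := by
  have he0 : ‖(EuclideanSpace.single 0 1 : E4)‖ = 1 := by simp
  obtain ⟨c, hc, -⟩ := lemE h hpos he0
  refine ⟨c, ?_⟩
  set p : E4 := EuclideanSpace.single 0 c with hp
  have hS : ∀ x, Φ ((2 : ℝ) • p - x) = Φ x := by
    intro x
    rw [← hc x]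
    apply hax
    · simp [Rf, hp, EuclideanSpace.inner_single_right]
      ring
    · simp [Rf, hp, rho2]
  have hse : ∀ e : E4, ‖e‖ = 1 → ∀ s, (∀ x, Φ (Rf e s x) = Φ x) → s = inner ℝ p e := by
    intro e he s hs
    by_contra hne
    have htr : ∀ y, Φ (y + (4 * (s - inner ℝ p e)) • e) = Φ y := by
      intro y
      have h1 : ∀ x, Φ (Rf e s ((2 : ℝ) • p - x)) = Φ ((2 : ℝ) • p - Rf e s x) := by
        intro x
        rw [hs, hS, hS, hs]
      have h2 := h1 (Rf e s ((2 : ℝ) • p - y))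
      rw [Rf_Rf he] at h2
      have h3 : (2 : ℝ) • p - ((2 : ℝ) • p - y) = y := by module
      rw [h3] at h2
      rw [← h2]
      congr 1
      have h4 := Rf_inner he s ((2 : ℝ) • p - y)
      rw [Rf, inner_sub_left, h4, Rf]
      simp only [inner_sub_left, inner_smul_left]
      simp
      module
    have htn : ∀ y, ∀ n : ℕ, Φ (y + ((n : ℝ) * (4 * (s - inner ℝ p e))) • e) = Φ y := by
      intro y n
      induction n with
      | zero => simp
      | succ n ih =>
        rw [← ih, ← htr (y + ((n : ℝ) * (4 * (s - inner ℝ p e))) • e)]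
        congr 1
        push_cast
        module
    obtain ⟨x₀, hx₀⟩ := hpos
    have hlim : Tendsto (fun n : ℕ => x₀ + ((n : ℝ) * (4 * (s - inner ℝ p e))) • e) atTop
        (cocompact E4) := by
      rw [← Metric.cobounded_eq_cocompact, ← comap_norm_atTop, tendsto_comap_iff]
      have hk : 0 < |4 * (s - inner ℝ p e)| := by
        rw [abs_pos]; intro h0; apply hne; linarith
      refine tendsto_atTop_mono (f := fun n : ℕ => (n : ℝ) * |4 * (s - inner ℝ p e)| + -‖x₀‖) ?_
        (tendsto_atTop_add_const_right _ _
          (tendsto_natCast_atTop_atTop.atTop_mul_const hk))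
      intro n
      have h1 : ‖((n : ℝ) * (4 * (s - inner ℝ p e))) • e‖ = n * |4 * (s - inner ℝ p e)| := by
        rw [norm_smul, he, Real.norm_eq_abs, abs_mul, Nat.abs_cast, mul_one]
      have h2 := norm_sub_norm_le (((n : ℝ) * (4 * (s - inner ℝ p e))) • e) (-x₀)
      rw [sub_neg_eq_add, add_comm _ x₀, norm_neg, h1] at h2
      simp only [Function.comp]
      linarith
    have := h.lim.comp hlim
    have h5 : (Φ ∘ fun n : ℕ => x₀ + ((n : ℝ) * (4 * (s - inner ℝ p e))) • e) =
        fun _ => Φ x₀ := by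
      funext n; exact htn x₀ n
    rw [h5] at this
    have := tendsto_nhds_unique this tendsto_const_nhds
    linarith
  intro x y hxy
  by_cases hne : x = y
  · rw [hne]
  have hd : 0 < ‖y - x‖ := norm_pos_iff.2 (sub_ne_zero.2 (Ne.symm hne))
  set e : E4 := (‖y - x‖⁻¹) • (y - x) with he_def
  have he : ‖e‖ = 1 := by
    rw [he_def, norm_smul, norm_inv, norm_norm, inv_mul_cancel₀ hd.ne']
  obtain ⟨s, hs1, hs2⟩ := lemE h hpos he
  have hs := hse e he s hs1
  have hye : ∀ z : E4, inner ℝ z e = ‖y - x‖⁻¹ * inner ℝ z (y - x) := by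
    intro z; rw [he_def, inner_smul_right]
  have hyx : inner ℝ (y - x) e = ‖y - x‖ := by
    rw [hye, real_inner_self_eq_norm_sq]; field_simp
  have hsq : ‖x - p‖ ^ 2 ≤ ‖y - p‖ ^ 2 := by gcongr
  have hdiff : inner ℝ (x + y - (2 : ℝ) • p) (y - x) = ‖y - p‖ ^ 2 - ‖x - p‖ ^ 2 := by
    have e1 : x + y - (2 : ℝ) • p = (y - p) + (x - p) := by module
    have e2 : y - x = (y - p) - (x - p) := by module
    rw [e1, e2, inner_sub_right, inner_add_left, inner_add_left, real_inner_self_eq_norm_sq,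
      real_inner_self_eq_norm_sq, real_inner_comm (y - p) (x - p)]
    ring
  have hge : 0 ≤ inner ℝ (x + y - (2 : ℝ) • p) e := by
    rw [hye, hdiff]
    have : 0 ≤ ‖y - p‖ ^ 2 - ‖x - p‖ ^ 2 := by linarith
    positivity
  rw [inner_sub_left, inner_add_left, inner_smul_left] at hge
  simp only [conj_trivial] at hge
  rw [inner_sub_left] at hyx
  have hkey := hs2 ((inner ℝ x e + inner ℝ y e) / 2) (by rw [hs]; linarith) y (by linarith)
  have : Rf e ((inner ℝ x e + inner ℝ y e) / 2) y = x := by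
    rw [Rf]
    have e1 : 2 * (inner ℝ y e - (inner ℝ x e + inner ℝ y e) / 2) = ‖y - x‖ := by
      linarith
    rw [e1, he_def, smul_smul, mul_inv_cancel₀ hd.ne']
    module
  rwa [this] at hkey


lemma sqrt_quot {g : ℝ → ℝ} {r : ℝ} (hr : 0 < r) (hg : ContDiffAt ℝ 2 g (√r)) :
    4 * r * deriv (deriv fun t => g (√t) / √t) r + 6 * deriv (fun t => g (√t) / √t) r
      = deriv (deriv g) (√r) / √r := by
  obtain ⟨h1, h2⟩ := c2_hasDeriv hg
  have hcs : Tendsto (fun t : ℝ => √t) (𝓝 r) (𝓝 (√r)) := Real.continuous_sqrt.tendsto r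
  have key : ∀ t : ℝ, 0 < t → HasDerivAt g (deriv g (√t)) (√t) →
      HasDerivAt (fun t => g (√t) / √t) ((deriv g (√t) / 2 - g (√t) / (2 * √t)) / t) t := by
    intro t ht hgt
    have hs := Real.hasDerivAt_sqrt ht.ne'
    have hst : 0 < √t := Real.sqrt_pos.2 ht
    have := (hgt.comp t hs).div hs hst.ne'
    refine this.congr_deriv ?_
    have : t = √t ^ 2 := (Real.sq_sqrt ht.le).symm
    simp only [Function.comp]
    generalize √t = σ at *
    subst this
    field_simp
  have hev : ∀ᶠ t in 𝓝 r, HasDerivAt (fun t => g (√t) / √t)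
      ((deriv g (√t) / 2 - g (√t) / (2 * √t)) / t) t := by
    filter_upwards [hcs.eventually h1, lt_mem_nhds hr] with t ht1 ht2
    exact key t ht2 ht1
  have hs := Real.hasDerivAt_sqrt hr.ne'
  have hst : 0 < √r := Real.sqrt_pos.2 hr
  have hd2 := (((h2.comp r hs).div_const 2).sub
    ((h1.self_of_nhds.comp r hs).div (hs.const_mul 2) (by positivity))).div
    (hasDerivAt_id r) hr.ne'
  rw [hev.self_of_nhds.deriv, deriv2_of hev hd2]
  simp only [Function.comp, id, Pi.sub_apply, Pi.div_apply]
  have : r = √r ^ 2 := (Real.sq_sqrt hr.le).symm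
  generalize √r = σ at *
  subst this
  field_simp
  ring

lemma closure_UHP : closure UHP = {x : ℝ × ℝ | 0 ≤ x.2} := by
  have : UHP = Set.univ ×ˢ Set.Ioi (0:ℝ) := by ext x; simp [UHP]
  rw [this, closure_prod_eq, closure_univ, closure_Ioi]
  ext x; simp

structure Hyp (lam W : ℝ) (ψ : ℝ × ℝ → ℝ) : Prop where
  lam1 : 1 < lam
  W0 : 0 < W
  reg : ContDiffOn ℝ 2 ψ (closure UHP)
  bdd : ∀ n : ℕ, n ≤ 2 →
      ∃ M : ℝ, ∀ x ∈ closure UHP, ‖iteratedFDerivWithin ℝ n ψ (closure UHP) x‖ ≤ M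
  UC : ∀ n : ℕ, n ≤ 2 →
      UniformContinuousOn (iteratedFDerivWithin ℝ n ψ (closure UHP)) (closure UHP)
  pos : ∀ x ∈ UHP, 0 < ψ x
  pde : ∀ x ∈ UHP, -lap ψ x + ψ x = lam * max (ψ x - W * x.2) 0
  bc : ∀ x₁ : ℝ, ψ (x₁, 0) = 0
  decay : ∀ ε : ℝ, 0 < ε → ∃ R : ℝ, ∀ x ∈ closure UHP, R ≤ rad x → |ψ x| ≤ ε

noncomputable def Pd (ψ : ℝ × ℝ → ℝ) (x : ℝ × ℝ) : ℝ :=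
  iteratedFDerivWithin ℝ 1 ψ (closure UHP) x (fun _ => (0, 1))

section
variable {lam W : ℝ} {ψ : ℝ × ℝ → ℝ}

lemma Hyp.c2 (h : Hyp lam W ψ) {x : ℝ × ℝ} (hx : 0 < x.2) : ContDiffAt ℝ 2 ψ x := by
  have : UHP ∈ 𝓝 x := (isOpen_lt continuous_const continuous_snd).mem_nhds hx
  exact h.reg.contDiffAt (Filter.mem_of_superset this subset_closure)

lemma Hyp.c2_1 (h : Hyp lam W ψ) {x y : ℝ} (hx : 0 < y) :
    ContDiffAt ℝ 2 (fun t => ψ (t, y)) x :=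
  (h.c2 (x := (x, y)) hx).comp x (contDiffAt_id.prodMk contDiffAt_const)

lemma Hyp.c2_2 (h : Hyp lam W ψ) {x y : ℝ} (hx : 0 < y) :
    ContDiffAt ℝ 2 (fun t => ψ (x, t)) y :=
  (h.c2 (x := (x, y)) hx).comp y (contDiffAt_const.prodMk contDiffAt_id)

lemma Hyp.Pd_deriv (h : Hyp lam W ψ) {x y : ℝ} (hy : 0 < y) :
    HasDerivAt (fun t => ψ (x, t)) (Pd ψ (x, y)) y := by
  have hn : closure UHP ∈ 𝓝 (x, y) := Filter.mem_of_superset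
    ((isOpen_lt continuous_const continuous_snd).mem_nhds (show (0:ℝ) < (x, y).2 from hy))
    (subset_closure)
  have h1 : Pd ψ (x, y) = fderiv ℝ ψ (x, y) (0, 1) := by
    rw [Pd, iteratedFDerivWithin_one_apply (uniqueDiffWithinAt_of_mem_nhds hn),
      fderivWithin_of_mem_nhds hn]
  rw [h1]
  have h2 := ((h.c2 (x := (x, y)) hy).differentiableAt (by norm_num)).hasFDerivAt
  have h3 : HasDerivAt (fun t : ℝ => (x, t)) ((0 : ℝ), (1 : ℝ)) y :=
    (hasDerivAt_const y x).prodMk (hasDerivAt_id y)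
  exact h2.comp_hasDerivAt y h3

lemma Hyp.Pd_UC (h : Hyp lam W ψ) {ε : ℝ} (hε : 0 < ε) : ∃ δ > 0, ∀ x y : ℝ × ℝ, 0 ≤ x.2 →
    0 ≤ y.2 → dist x y < δ → |Pd ψ x - Pd ψ y| < ε := by
  have := h.UC 1 (by norm_num)
  rw [Metric.uniformContinuousOn_iff] at this
  obtain ⟨δ, hδ, H⟩ := this ε hε
  refine ⟨δ, hδ, fun x y hx hy hxy => ?_⟩
  have h1 := H x (by rw [closure_UHP]; exact hx) y (by rw [closure_UHP]; exact hy) hxy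
  refine lt_of_le_of_lt ?_ h1
  rw [dist_eq_norm]
  have h2 := (iteratedFDerivWithin ℝ 1 ψ (closure UHP) x -
    iteratedFDerivWithin ℝ 1 ψ (closure UHP) y).le_opNorm (fun _ => ((0:ℝ), (1:ℝ)))
  simpa [Pd] using h2

lemma Hyp.Pd_bdd (h : Hyp lam W ψ) : ∃ M : ℝ, ∀ x : ℝ × ℝ, 0 ≤ x.2 → |Pd ψ x| ≤ M := by
  obtain ⟨M, hM⟩ := h.bdd 1 (by norm_num)
  refine ⟨M, fun x hx => ?_⟩
  refine le_trans ?_ (hM x (by rw [closure_UHP]; exact hx))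
  have h2 := (iteratedFDerivWithin ℝ 1 ψ (closure UHP) x).le_opNorm (fun _ => ((0:ℝ), (1:ℝ)))
  simpa [Pd] using h2

noncomputable def ph (ψ : ℝ × ℝ → ℝ) (p : ℝ × ℝ) : ℝ := if p.2 = 0 then Pd ψ p else ψ p / p.2

lemma Hyp.mvt (h : Hyp lam W ψ) (x : ℝ) {y : ℝ} (hy : 0 ≤ y) :
    ∃ ξ, 0 ≤ ξ ∧ ξ ≤ y ∧ ph ψ (x, y) = Pd ψ (x, ξ) := by
  rcases hy.eq_or_lt with h0 | h0
  · exact ⟨0, le_rfl, hy, by simp [ph, ← h0]⟩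
  · have hc : ContinuousOn (fun t => ψ (x, t)) (Set.Icc 0 y) := by
      refine h.reg.continuousOn.comp (by fun_prop) fun t ht => ?_
      rw [closure_UHP]; exact ht.1
    obtain ⟨ξ, hξ, he⟩ := exists_hasDerivAt_eq_slope (fun t => ψ (x, t)) (fun t => Pd ψ (x, t)) h0 hc
      (fun t ht => h.Pd_deriv ht.1)
    refine ⟨ξ, hξ.1.le, hξ.2.le, ?_⟩
    rw [he]
    simp [ph, h0.ne', h.bc]

lemma Hyp.ph_cont (h : Hyp lam W ψ) : ContinuousOn (ph ψ) {p | 0 ≤ p.2} := by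
  intro p hp
  have hp : 0 ≤ p.2 := hp
  rcases hp.eq_or_lt with h0 | h0
  · rw [Metric.continuousWithinAt_iff]
    intro ε hε
    obtain ⟨δ, hδ, H⟩ := h.Pd_UC hε
    refine ⟨δ, hδ, fun {y} hy hyd => ?_⟩
    obtain ⟨y1, y2⟩ := y
    obtain ⟨p1, p2⟩ := p
    simp only at h0
    subst h0
    obtain ⟨ξ, h1, h2, h3⟩ := h.mvt y1 (y := y2) hy
    rw [h3, Real.dist_eq]
    have : ph ψ (p1, 0) = Pd ψ (p1, 0) := by simp [ph]
    rw [this]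
    apply H _ _ h1 le_rfl
    refine lt_of_le_of_lt ?_ hyd
    simp only [Prod.dist_eq, Real.dist_eq, sub_zero]
    rw [abs_of_nonneg h1, abs_of_nonneg (h1.trans h2)]
    gcongr
  · have h1 : ContinuousAt (fun q : ℝ × ℝ => ψ q / q.2) p :=
      (h.c2 h0).continuousAt.div continuousAt_snd h0.ne'
    refine ContinuousAt.continuousWithinAt ?_
    refine h1.congr ?_
    have : ∀ᶠ q : ℝ × ℝ in 𝓝 p, 0 < q.2 :=
      (isOpen_lt continuous_const continuous_snd).mem_nhds h0
    filter_upwards [this] with q hq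
    simp [ph, hq.ne']

noncomputable def Ph (ψ : ℝ × ℝ → ℝ) (x : E4) : ℝ := ph ψ (x 0, √(rho2 x))

lemma Ph_eq {x : E4} (hx : 0 < rho2 x) : Ph ψ x = ψ (x 0, √(rho2 x)) / √(rho2 x) := by
  simp [Ph, ph, (Real.sqrt_pos.2 hx).ne']

lemma rad_eq (x : E4) : rad (x 0, √(rho2 x)) = ‖x‖ := by
  rw [rad, EuclideanSpace.norm_eq]
  congr 1
  simp only
  rw [Real.sq_sqrt (rho2_nonneg x)]
  simp [Fin.sum_univ_four, rho2]
  ring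

lemma Hyp.sol (h : Hyp lam W ψ) : Sol lam W (Ph ψ) := by
  have hc2 : ∀ x, rho2 x ≠ 0 → ContDiffAt ℝ 2 (Ph ψ) x := by
    intro x hx
    have hx : 0 < rho2 x := lt_of_le_of_ne (rho2_nonneg x) (Ne.symm hx)
    have hs : ContDiffAt ℝ 2 (fun y => √(rho2 y)) x := rho2_contDiff.contDiffAt.sqrt hx.ne'
    have h0 : ContDiffAt ℝ 2 (fun y : E4 => y 0) x := by fun_prop
    have hsx := Real.sqrt_pos.2 hx
    have h1 : ContDiffAt ℝ 2 (fun y : E4 => ψ (y 0, √(rho2 y))) x :=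
      (h.c2 (x := (x 0, √(rho2 x))) hsx).comp x (h0.prodMk hs)
    refine (h1.div hs hsx.ne').congr_of_eventuallyEq ?_
    filter_upwards [rho2_cont.continuousAt.eventually (lt_mem_nhds hx)] with y hy
    exact Ph_eq hy
  refine ⟨h.lam1, h.W0, ?_, ?_, hc2, ?_⟩
  · refine h.ph_cont.comp_continuous (f := fun x : E4 => (x 0, √(rho2 x))) ?_ ?_
    · have := rho2_cont
      fun_prop
    · intro x; exact Real.sqrt_nonneg _
  · rw [Metric.tendsto_nhds]
    intro ε hε
    obtain ⟨δ, hδ, H⟩ := h.Pd_UC (half_pos hε)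
    obtain ⟨R, hR⟩ := h.decay (ε / 4 * (δ / 2)) (by positivity)
    have hbig : ∀ x1 y : ℝ, δ / 2 ≤ y → R ≤ rad (x1, y) → |ph ψ (x1, y)| ≤ ε / 4 := by
      intro x1 y hy hr
      have hy0 : 0 < y := by linarith
      have h1 := hR (x1, y) (by rw [closure_UHP]; exact hy0.le) hr
      simp only [ph, hy0.ne', if_false]
      rw [abs_div, abs_of_pos hy0, div_le_iff₀ hy0]
      refine h1.trans ?_
      gcongr
    rw [← Metric.cobounded_eq_cocompact]
    have hev : ∀ᶠ x : E4 in Bornology.cobounded E4, R ≤ ‖x‖ :=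
      tendsto_norm_cobounded_atTop.eventually_ge_atTop R
    filter_upwards [hev] with x hx
    rw [Real.dist_eq, sub_zero]
    rw [← rad_eq] at hx
    unfold Ph
    have hs0 := Real.sqrt_nonneg (rho2 x)
    set ρ := √(rho2 x)
    rcases le_or_gt (δ / 2) ρ with h1 | h1
    · have := hbig _ _ h1 hx
      linarith
    · have h2 : rad (x 0, ρ) ≤ rad (x 0, δ / 2) := by
        unfold rad
        apply Real.sqrt_le_sqrt
        simp only
        gcongr
      have h3 := hbig (x 0) (δ / 2) le_rfl (hx.trans h2)
      obtain ⟨ξ, a1, a2, a3⟩ := h.mvt (x 0) hs0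
      obtain ⟨η, b1, b2, b3⟩ := h.mvt (x 0) (y := δ / 2) (by positivity)
      have h4 := H (x 0, ξ) (x 0, η) a1 b1 (by
        simp only [Prod.dist_eq, dist_self, Real.dist_eq]
        rw [max_lt_iff]
        refine ⟨hδ, ?_⟩
        rw [abs_lt]; constructor <;> linarith)
      rw [a3]
      rw [b3] at h3
      rw [abs_lt] at h4 ⊢
      rw [abs_le] at h3
      constructor <;> linarith [h4.1, h4.2, h3.1, h3.2]
  · intro x hx0
    have hx : 0 < rho2 x := lt_of_le_of_ne (rho2_nonneg x) (Ne.symm hx0)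
    have hsx := Real.sqrt_pos.2 hx
    have hp := h.pde (x 0, √(rho2 x)) hsx
    have hlap : Δ (Ph ψ) x = lap ψ (x 0, √(rho2 x)) / √(rho2 x) := by
      rw [lap_line (hc2 x hx0) (EuclideanSpace.basisFun (Fin 4) ℝ), Fin.sum_univ_four]
      have e0 : deriv (deriv fun t : ℝ => Ph ψ (x + t • EuclideanSpace.basisFun (Fin 4) ℝ 0)) 0
          = deriv (deriv fun t => ψ (t, √(rho2 x))) (x 0) / √(rho2 x) := by
        have : (fun t : ℝ => Ph ψ (x + t • EuclideanSpace.basisFun (Fin 4) ℝ 0)) =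
            fun t => ψ (x 0 + t, √(rho2 x)) / √(rho2 x) := by
          funext t
          have hr : rho2 (x + t • EuclideanSpace.basisFun (Fin 4) ℝ 0) = rho2 x := by
            simp [rho2]
          rw [Ph_eq (by rw [hr]; exact hx), hr]
          simp
        rw [this]
        have d1 : (deriv fun t => ψ (x 0 + t, √(rho2 x)) / √(rho2 x)) =
          fun t => deriv (fun t => ψ (t, √(rho2 x))) (x 0 + t) / √(rho2 x) := by
          funext t
          rw [deriv_div_const]
          congr 1
          exact deriv_comp_const_add (f := fun t => ψ (t, √(rho2 x))) _ _
        rw [d1, deriv_div_const]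
        congr 1
        rw [deriv_comp_const_add (f := deriv (fun t => ψ (t, √(rho2 x)))), add_zero]
      set g : ℝ → ℝ := fun t => ψ (x 0, t) with hg
      have hg2 : ContDiffAt ℝ 2 g (√(rho2 x)) := h.c2_2 hsx
      have hH : ContDiffAt ℝ 2 (fun t => g (√t) / √t) (rho2 x) :=
        (hg2.comp (rho2 x) (Real.contDiffAt_sqrt hx.ne')).div
          (Real.contDiffAt_sqrt hx.ne') hsx.ne'
      have ei : ∀ i : Fin 4, i ≠ 0 →
          deriv (deriv fun t : ℝ => Ph ψ (x + t • EuclideanSpace.basisFun (Fin 4) ℝ i)) 0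
          = deriv (deriv fun t => g (√t) / √t) (rho2 x) * (2 * x i) ^ 2 +
            2 * 1 * deriv (fun t => g (√t) / √t) (rho2 x) := by
        intro i hi
        rw [← line_comp _ _ _ _ hH]
        have hr : ∀ t : ℝ, rho2 (x + t • EuclideanSpace.basisFun (Fin 4) ℝ i) =
            rho2 x + t * (2 * x i) + t ^ 2 * 1 := by
          intro t
          fin_cases i
          · exact absurd rfl hi
          all_goals simp [rho2]; ring
        have hx00 : ∀ t : ℝ, (x + t • EuclideanSpace.basisFun (Fin 4) ℝ i) 0 = x 0 := by
          intro t
          simp [hi.symm]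
        have : (fun t : ℝ => Ph ψ (x + t • EuclideanSpace.basisFun (Fin 4) ℝ i)) =ᶠ[𝓝 0]
            fun t => g (√(rho2 x + t * (2 * x i) + t ^ 2 * 1)) /
              √(rho2 x + t * (2 * x i) + t ^ 2 * 1) := by
          have hc : Continuous fun t : ℝ => rho2 x + t * (2 * x i) + t ^ 2 * 1 := by fun_prop
          have := hc.continuousAt.eventually (lt_mem_nhds (a := 0) (b := rho2 x + 0 * (2 * x i) + 0 ^ 2 * 1)
            (by simpa using hx))
          filter_upwards [this] with t ht
          rw [Ph_eq (by rw [hr]; exact ht), hr, hx00]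
        exact this.deriv.deriv_eq
      rw [e0, ei 1 (by decide), ei 2 (by decide), ei 3 (by decide)]
      have hq := sqrt_quot hx hg2
      rw [lap, add_div]
      simp only
      rw [← hg, ← hq]
      have : rho2 x = x 1 ^ 2 + x 2 ^ 2 + x 3 ^ 2 := rfl
      generalize deriv (deriv fun t => g (√t) / √t) (rho2 x) = A
      generalize deriv (fun t => g (√t) / √t) (rho2 x) = B
      rw [this]
      ring
    rw [hlap, Ph_eq hx]
    have e1 : ψ (x 0, √(rho2 x)) / √(rho2 x) - W =
      (ψ (x 0, √(rho2 x)) - W * √(rho2 x)) / √(rho2 x) := by field_simp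
    have e2 : max (ψ (x 0, √(rho2 x)) / √(rho2 x) - W) 0 =
        max (ψ (x 0, √(rho2 x)) - W * √(rho2 x)) 0 / √(rho2 x) := by
      rw [e1]
      have := max_div_div_right hsx.le (ψ (x 0, √(rho2 x)) - W * √(rho2 x)) 0
      rw [← this, zero_div]
    rw [e2]
    simp only at hp
    have hp' : lap ψ (x 0, √(rho2 x)) = ψ (x 0, √(rho2 x)) - lam * max (ψ (x 0, √(rho2 x)) - W * √(rho2 x)) 0 := by
      linarith
    rw [hp']
    field_simp

/-- radial structure of the solution -/
lemma Hyp.radial (h : Hyp lam W ψ) : ∃ c : ℝ, ∃ U : ℝ → ℝ, AntitoneOn U (Set.Ici 0) ∧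
    ContinuousOn U (Set.Ici 0) ∧
    ∀ x y : ℝ, 0 < y → ψ (x, y) = y * U (rad (x + c, y)) := by
  obtain ⟨c, hc⟩ := lemF h.sol ⟨EuclideanSpace.single 1 1, by
    have : rho2 (EuclideanSpace.single 1 1 : E4) = 1 := by simp [rho2]
    rw [Ph_eq (by rw [this]; norm_num), this]
    simp
    exact h.pos _ (show (0:ℝ) < 1 by norm_num)⟩ (by
      intro x y h0 h1; simp [Ph, h0, h1])
  have hn : ∀ r : ℝ, 0 ≤ r → ‖(EuclideanSpace.single 0 c + EuclideanSpace.single 1 r : E4) -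
      EuclideanSpace.single 0 c‖ = r := by
    intro r hr; simp [abs_of_nonneg hr]
  refine ⟨-c, fun r => Ph ψ (EuclideanSpace.single 0 c + EuclideanSpace.single 1 r), ?_, ?_, ?_⟩
  · intro r hr s hs hrs
    apply hc
    rw [hn r hr, hn s hs]
    exact hrs
  · apply Continuous.continuousOn
    refine h.sol.cont.comp ?_
    refine continuous_const.add ?_
    have : (fun r : ℝ => (EuclideanSpace.single 1 r : E4)) = fun r => r • EuclideanSpace.single 1 1 := by
      funext r; ext i; simp [EuclideanSpace.single, Pi.single_apply]
    have h3 : Continuous fun r : ℝ => (EuclideanSpace.single 1 r : E4) := by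
      rw [this]
      fun_prop
    exact h3
  · intro x y hy
    set X : E4 := EuclideanSpace.single 0 x + EuclideanSpace.single 1 y with hX
    have hr : rho2 X = y ^ 2 := by simp [hX, rho2]
    have hs : √(rho2 X) = y := by rw [hr, Real.sqrt_sq hy.le]
    have hX0 : X 0 = x := by simp [hX]
    have h1 : Ph ψ X = ψ (x, y) / y := by
      rw [Ph_eq (by rw [hr]; positivity), hs, hX0]
    have hnX : ‖X - EuclideanSpace.single 0 c‖ = rad (x + -c, y) := by
      rw [rad, EuclideanSpace.norm_eq]
      congr 1
      simp [Fin.sum_univ_four, hX]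
      ring
    have hrad : 0 ≤ rad (x + -c, y) := Real.sqrt_nonneg _
    have h2 : Ph ψ X = Ph ψ (EuclideanSpace.single 0 c + EuclideanSpace.single 1 (rad (x + -c, y))) := by
      apply le_antisymm
      · apply hc; rw [hn _ hrad, hnX]
      · apply hc; rw [hn _ hrad, hnX]
    change ψ (x, y) = y * Ph ψ (EuclideanSpace.single 0 c + EuclideanSpace.single 1 (rad (x + -c, y)))
    rw [← h2, h1]
    field_simp
end


/-! ### power series for J1 -/
noncomputable def Ser (c : ℕ → ℝ) (z : ℝ) : ℝ := ∑' k, c k * z ^ k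

def Dc (c : ℕ → ℝ) (k : ℕ) : ℝ := (k + 1) * c (k + 1)

lemma Dc_bd {c : ℕ → ℝ} (hc : ∀ k, |c k| ≤ 1 / (k.factorial : ℝ)) :
    ∀ k, |Dc c k| ≤ 1 / (k.factorial : ℝ) := by
  intro k
  rw [Dc, abs_mul]
  have h1 : |((k : ℝ) + 1)| = k + 1 := abs_of_nonneg (by positivity)
  rw [h1]
  calc ((k : ℝ) + 1) * |c (k + 1)| ≤ (k + 1) * (1 / ((k + 1).factorial : ℝ)) := by
        gcongr; exact hc _
    _ = 1 / (k.factorial : ℝ) := by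
        rw [Nat.factorial_succ]; push_cast
        have : (k.factorial : ℝ) ≠ 0 := by positivity
        field_simp

lemma Ser_summable {c : ℕ → ℝ} (hc : ∀ k, |c k| ≤ 1 / (k.factorial : ℝ)) (z : ℝ) :
    Summable fun k => c k * z ^ k := by
  refine Summable.of_norm_bounded (g := fun k => |z| ^ k / (k.factorial : ℝ))
    (Real.summable_pow_div_factorial |z|) fun k => ?_
  rw [Real.norm_eq_abs, abs_mul, abs_pow]
  calc |c k| * |z| ^ k ≤ 1 / (k.factorial : ℝ) * |z| ^ k := by gcongr; exact hc k
    _ = _ := by ring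

lemma Ser_deriv {c : ℕ → ℝ} (hc : ∀ k, |c k| ≤ 1 / (k.factorial : ℝ)) (z : ℝ) :
    HasDerivAt (Ser c) (Ser (Dc c) z) z := by
  set R : ℝ := |z| + 1
  have hR : 0 < R := by positivity
  have hu : Summable fun n : ℕ => (n : ℝ) * R ^ (n - 1) / (n.factorial : ℝ) := by
    rw [← summable_nat_add_iff 1]
    refine (Real.summable_pow_div_factorial R).congr fun n => ?_
    rw [Nat.factorial_succ]; push_cast
    have : (n.factorial : ℝ) ≠ 0 := by positivity
    field_simp
  have hzt : z ∈ Metric.ball (0:ℝ) R := by simp [R]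
  have h := hasDerivAt_tsum_of_isPreconnected (𝕜 := ℝ) (F := ℝ)
    (g := fun n y => c n * y ^ n) (g' := fun n y => c n * (n * y ^ (n - 1))) hu
    (t := Metric.ball (0:ℝ) R) Metric.isOpen_ball (convex_ball _ _).isPreconnected
    (fun n y _ => (hasDerivAt_pow n y).const_mul (c n)) (fun n y hy => ?_) hzt
    (Ser_summable hc z) hzt
  · refine h.congr_deriv ?_
    have hs : Summable fun n : ℕ => c n * (n * z ^ (n - 1)) := by
      rw [← summable_nat_add_iff 1]
      refine (Ser_summable (Dc_bd hc) z).congr fun n => ?_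
      simp [Dc]; ring
    rw [hs.tsum_eq_zero_add, Ser]
    simp only [Nat.cast_zero, zero_mul, mul_zero, zero_add]
    refine tsum_congr fun n => ?_
    simp [Dc]; ring
  · rw [mem_ball_zero_iff, Real.norm_eq_abs] at hy
    rw [Real.norm_eq_abs, abs_mul, abs_mul, abs_pow, Nat.abs_cast]
    calc |c n| * (n * |y| ^ (n - 1)) ≤ 1 / (n.factorial : ℝ) * (n * R ^ (n - 1)) := by
          gcongr
          exact hc n
      _ = _ := by ring

noncomputable def jc (k : ℕ) : ℝ := (-1) ^ k / ((k.factorial : ℝ) * ((k + 1).factorial : ℝ))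

lemma jc_bd (k : ℕ) : |jc k| ≤ 1 / (k.factorial : ℝ) := by
  rw [jc, abs_div, abs_pow]
  have h1 : (1 : ℝ) ≤ ((k + 1).factorial : ℝ) := by exact_mod_cast Nat.one_le_iff_ne_zero.2 (Nat.factorial_ne_zero _)
  have h2 : (0 : ℝ) < (k.factorial : ℝ) := by positivity
  rw [abs_of_pos (a := (k.factorial : ℝ) * ((k + 1).factorial : ℝ)) (by positivity)]
  simp only [abs_neg, abs_one, one_pow]
  gcongr
  nlinarith

lemma jc_ode (z : ℝ) : z * Ser (Dc (Dc jc)) z + 2 * Ser (Dc jc) z + Ser jc z = 0 := by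
  have s0 := Ser_summable jc_bd z
  have s1 := Ser_summable (Dc_bd jc_bd) z
  have s2 := Ser_summable (Dc_bd (Dc_bd jc_bd)) z
  have e2 : z * Ser (Dc (Dc jc)) z = ∑' k : ℕ, (k : ℝ) * Dc jc k * z ^ k := by
    have hs : Summable fun k : ℕ => (k : ℝ) * Dc jc k * z ^ k := by
      rw [← summable_nat_add_iff 1]
      refine (s2.mul_left z).congr fun n => ?_
      simp [Dc]; ring
    rw [hs.tsum_eq_zero_add, Ser, ← tsum_mul_left]
    simp only [Nat.cast_zero, zero_mul, zero_add]
    refine tsum_congr fun n => ?_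
    simp [Dc]; ring
  have hs : Summable fun k : ℕ => (k : ℝ) * Dc jc k * z ^ k := by
    rw [← summable_nat_add_iff 1]
    refine (s2.mul_left z).congr fun n => ?_
    simp [Dc]; ring
  rw [e2, Ser, Ser, ← tsum_mul_left, ← hs.tsum_add (s1.mul_left 2),
    ← (hs.add (s1.mul_left 2)).tsum_add s0]
  rw [← tsum_zero (α := ℝ) (β := ℕ)]
  refine tsum_congr fun k => ?_
  have : ((k : ℝ) + 2) * Dc jc k + jc k = 0 := by
    rw [Dc, jc, jc]
    have h2 : ((k.factorial : ℕ) : ℝ) ≠ 0 := by positivity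
    rw [Nat.factorial_succ (k + 1), Nat.factorial_succ k]
    push_cast
    have h3 : (k : ℝ) + 1 ≠ 0 := by positivity
    have h4 : (k : ℝ) + 1 + 1 ≠ 0 := by positivity
    field_simp
    ring
  calc (k : ℝ) * Dc jc k * z ^ k + 2 * (Dc jc k * z ^ k) + jc k * z ^ k
      = (((k : ℝ) + 2) * Dc jc k + jc k) * z ^ k := by ring
    _ = 0 := by rw [this, zero_mul]

lemma J1_eq (r : ℝ) : J1 r = r / 2 * Ser jc (r ^ 2 / 4) := by
  rw [J1, Ser, ← tsum_mul_left]
  refine tsum_congr fun k => ?_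
  rw [jc, pow_succ, pow_mul]
  have : (r / 2) ^ 2 = r ^ 2 / 4 := by ring
  rw [this]; ring

lemma J1_d1 (s : ℝ) : HasDerivAt J1 (Ser jc (s ^ 2 / 4) / 2 + s ^ 2 / 4 * Ser (Dc jc) (s ^ 2 / 4)) s := by
  have : J1 = fun r => r / 2 * Ser jc (r ^ 2 / 4) := funext J1_eq
  rw [this]
  have hz : HasDerivAt (fun s : ℝ => s ^ 2 / 4) (s / 2) s :=
    ((hasDerivAt_pow 2 s).div_const 4).congr_deriv (by simp; ring)
  have h1 := (Ser_deriv jc_bd (s ^ 2 / 4)).comp s hz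
  refine (((hasDerivAt_id s).div_const 2).mul h1).congr_deriv ?_
  simp [Function.comp]; ring

lemma J1_hasDeriv (s : ℝ) : HasDerivAt J1 (deriv J1 s) s := (J1_d1 s).differentiableAt.hasDerivAt

lemma J1_zero : J1 0 = 0 := by rw [J1_eq]; simp

lemma J1_d1_zero : deriv J1 0 = 1 / 2 := by
  rw [(J1_d1 0).deriv, Ser]
  rw [tsum_eq_single 0]
  · simp [jc]
  · intro k hk; simp [hk]

lemma J1_ode {s : ℝ} (hs : s ≠ 0) :
    HasDerivAt (deriv J1) (J1 s / s ^ 2 - J1 s - deriv J1 s / s) s := by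
  have : deriv J1 = fun s => Ser jc (s ^ 2 / 4) / 2 + s ^ 2 / 4 * Ser (Dc jc) (s ^ 2 / 4) :=
    funext fun s => (J1_d1 s).deriv
  rw [this]
  have hz : HasDerivAt (fun s : ℝ => s ^ 2 / 4) (s / 2) s :=
    ((hasDerivAt_pow 2 s).div_const 4).congr_deriv (by simp; ring)
  have h1 := (Ser_deriv jc_bd (s ^ 2 / 4)).comp s hz
  have h2 := (Ser_deriv (Dc_bd jc_bd) (s ^ 2 / 4)).comp s hz
  refine ((h1.div_const 2).add (hz.mul h2)).congr_deriv ?_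
  have := jc_ode (s ^ 2 / 4)
  rw [J1_eq]
  simp only [Function.comp]
  generalize Ser jc (s ^ 2 / 4) = f at *
  generalize Ser (Dc jc) (s ^ 2 / 4) = f1 at *
  generalize Ser (Dc (Dc jc)) (s ^ 2 / 4) = f2 at *
  field_simp
  linear_combination 8 * s ^ 2 * this

lemma J1_cont : Continuous J1 := continuous_iff_continuousAt.2 fun s => (J1_hasDeriv s).continuousAt

lemma J1_bracket {s : ℝ} (hs : 0 ≤ s) : 0 ≤ s ^ 2 * deriv J1 s ^ 2 + (s ^ 2 - 1) * J1 s ^ 2 := by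
  set B : ℝ → ℝ := fun s => s ^ 2 * deriv J1 s ^ 2 + (s ^ 2 - 1) * J1 s ^ 2 with hB
  have hd1 : Continuous (deriv J1) := by
    have hS : ∀ c : ℕ → ℝ, (∀ k, |c k| ≤ 1 / (k.factorial : ℝ)) → Continuous (Ser c) :=
      fun c hc => continuous_iff_continuousAt.2 fun s => (Ser_deriv hc s).continuousAt
    have : deriv J1 = fun s => Ser jc (s ^ 2 / 4) / 2 + s ^ 2 / 4 * Ser (Dc jc) (s ^ 2 / 4) :=
      funext fun s => (J1_d1 s).deriv
    rw [this]
    have a1 := hS _ jc_bd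
    have a2 := hS _ (Dc_bd jc_bd)
    fun_prop
  have hJ := J1_cont
  have hm : MonotoneOn B (Set.Ici 0) := by
    refine monotoneOn_of_hasDerivWithinAt_nonneg (f' := fun s => 2 * s * J1 s ^ 2) (convex_Ici 0)
      (by rw [hB]; fun_prop) ?_ ?_
    · intro x hx
      rw [interior_Ici] at hx
      have hx : 0 < x := hx
      have h1 := J1_hasDeriv x
      have h2 := J1_ode hx.ne'
      have := (((hasDerivAt_pow 2 x).mul (h2.pow 2)).add
        (((hasDerivAt_pow 2 x).sub_const 1).mul (h1.pow 2)))
      refine (this.congr_deriv ?_).hasDerivWithinAt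
      simp
      field_simp
      ring
    · intro x hx
      rw [interior_Ici] at hx
      have hx : 0 < x := hx
      positivity
  have := hm (Set.mem_Ici.2 le_rfl) (Set.mem_Ici.2 hs) hs
  have h0 : B 0 = 0 := by simp [hB, J1_zero]
  rw [h0] at this
  exact this


noncomputable def Kf (n : ℕ) (r t : ℝ) : ℝ := Real.exp (-(r * Real.cosh t)) * Real.cosh t ^ n

noncomputable def In (n : ℕ) (r : ℝ) : ℝ := ∫ t in Set.Ioi (0 : ℝ), Kf n r t

lemma K1_eq : K1 = In 1 := by
  funext r; simp [K1, In, Kf]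

lemma Kf_cont (n : ℕ) (r : ℝ) : Continuous (Kf n r) := by
  unfold Kf
  have := Real.continuous_cosh
  fun_prop

lemma Kf_pos (n : ℕ) (r t : ℝ) : 0 < Kf n r t := by
  unfold Kf
  have := Real.cosh_pos t
  positivity

lemma le_cosh (t : ℝ) : t ≤ Real.cosh t := by
  rcases le_or_gt t 0 with h | h
  · exact h.trans (Real.cosh_pos t).le
  · exact (Real.self_le_sinh_iff.2 h.le).trans (Real.sinh_lt_cosh t).le

lemma Kf_bd (n : ℕ) {r : ℝ} (hr : 0 < r) (t : ℝ) :
    Kf n r t ≤ (n.factorial : ℝ) * (2 / r) ^ n * Real.exp (-(r / 2) * t) := by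
  have hc := Real.cosh_pos t
  have h1 := Real.pow_div_factorial_le_exp (x := r / 2 * Real.cosh t) (by positivity) n
  have hf : (0 : ℝ) < (n.factorial : ℝ) := by positivity
  rw [div_le_iff₀ hf, mul_pow] at h1
  have h2 : Real.cosh t ^ n ≤ (n.factorial : ℝ) * (2 / r) ^ n * Real.exp (r / 2 * Real.cosh t) := by
    calc Real.cosh t ^ n = (2 / r) ^ n * ((r / 2) ^ n * Real.cosh t ^ n) := by
          rw [← mul_assoc, ← mul_pow]
          have : 2 / r * (r / 2) = 1 := by field_simp
          rw [this]; simp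
      _ ≤ (2 / r) ^ n * (Real.exp (r / 2 * Real.cosh t) * (n.factorial : ℝ)) := by gcongr
      _ = _ := by ring
  calc Kf n r t ≤ Real.exp (-(r * Real.cosh t)) *
        ((n.factorial : ℝ) * (2 / r) ^ n * Real.exp (r / 2 * Real.cosh t)) := by
        unfold Kf; gcongr
    _ = (n.factorial : ℝ) * (2 / r) ^ n * (Real.exp (-(r * Real.cosh t)) * Real.exp (r / 2 * Real.cosh t)) := by ring
    _ = (n.factorial : ℝ) * (2 / r) ^ n * Real.exp (-(r / 2) * Real.cosh t) := by
        rw [← Real.exp_add]; congr 2; ring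
    _ ≤ _ := by
        have h3 := le_cosh t
        have : -(r / 2) * Real.cosh t ≤ -(r / 2) * t := by nlinarith
        gcongr

lemma Kf_int (n : ℕ) {r : ℝ} (hr : 0 < r) : IntegrableOn (Kf n r) (Set.Ioi 0) := by
  have h1 := (exp_neg_integrableOn_Ioi 0 (half_pos hr)).const_mul ((n.factorial : ℝ) * (2 / r) ^ n)
  refine h1.mono' (Kf_cont n r).aestronglyMeasurable ?_
  refine ae_of_all _ fun t => ?_
  rw [Real.norm_eq_abs, abs_of_pos (Kf_pos n r t)]
  exact Kf_bd n hr t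

lemma Kf_anti (n : ℕ) {r s t : ℝ} (h : r ≤ s) : Kf n s t ≤ Kf n r t := by
  unfold Kf
  have := Real.cosh_pos t
  gcongr

lemma In_pos (n : ℕ) {r : ℝ} (hr : 0 < r) : 0 < In n r := by
  rw [In, setIntegral_pos_iff_support_of_nonneg_ae (ae_of_all _ fun t => (Kf_pos n r t).le) (Kf_int n hr)]
  have : Function.support (Kf n r) = Set.univ := by
    ext t; simp [(Kf_pos n r t).ne']
  rw [this]; simp

lemma In_deriv (n : ℕ) {r : ℝ} (hr : 0 < r) : HasDerivAt (In n) (-In (n + 1) r) r := by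
  have h := hasDerivAt_integral_of_dominated_loc_of_deriv_le (𝕜 := ℝ) (E := ℝ)
    (μ := volume.restrict (Set.Ioi (0:ℝ))) (F := fun r t => Kf n r t)
    (F' := fun r t => -Kf (n + 1) r t) (x₀ := r) (s := Set.Ioi (r / 2)) (bound := Kf (n + 1) (r / 2))
    (Ioi_mem_nhds (by linarith)) (Eventually.of_forall fun s => (Kf_cont n s).aestronglyMeasurable)
    (Kf_int n hr) (Kf_cont (n + 1) r).neg.aestronglyMeasurable
    (ae_of_all _ fun t s hs => by
      rw [norm_neg, Real.norm_eq_abs, abs_of_pos (Kf_pos _ _ _)]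
      exact Kf_anti _ (le_of_lt hs))
    (Kf_int _ (half_pos hr))
    (ae_of_all _ fun t s _ => by
      have h1 : HasDerivAt (fun r => -(r * Real.cosh t)) (-Real.cosh t) s :=
        (((hasDerivAt_id s).mul_const (Real.cosh t)).neg).congr_deriv (by simp)
      exact ((h1.exp).mul_const (Real.cosh t ^ n)).congr_deriv (by unfold Kf; ring))
  refine h.2.congr_deriv ?_
  rw [integral_neg]; rfl

lemma In_decay (n : ℕ) {r : ℝ} (hr : 1 ≤ r) : In n r ≤ Real.exp (1 - r) * In n 1 := by
  rw [In, In, ← integral_const_mul]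
  refine setIntegral_mono (Kf_int n (by linarith)) ((Kf_int n one_pos).const_mul _) fun t => ?_
  unfold Kf
  have hc := Real.one_le_cosh t
  calc Real.exp (-(r * Real.cosh t)) * Real.cosh t ^ n
      ≤ Real.exp ((1 - r) + -(1 * Real.cosh t)) * Real.cosh t ^ n := by
        have : -(r * Real.cosh t) ≤ (1 - r) + -(1 * Real.cosh t) := by nlinarith
        gcongr
    _ = _ := by rw [Real.exp_add]; ring

lemma In_tendsto (n m : ℕ) : Tendsto (fun r => r ^ m * In n r) atTop (𝓝 0) := by
  have h1 : Tendsto (fun r : ℝ => (Real.exp 1 * In n 1) * (r ^ m * Real.exp (-r))) atTop (𝓝 0) := by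
    have := (Real.tendsto_pow_mul_exp_neg_atTop_nhds_zero m).const_mul (Real.exp 1 * In n 1)
    rwa [mul_zero] at this
  refine squeeze_zero' ?_ ?_ h1
  · filter_upwards [eventually_gt_atTop 0] with r hr
    have := In_pos n hr
    positivity
  · filter_upwards [eventually_ge_atTop 1] with r hr
    calc r ^ m * In n r ≤ r ^ m * (Real.exp (1 - r) * In n 1) := by
          gcongr
          exact In_decay n hr
      _ = _ := by rw [sub_eq_add_neg, Real.exp_add]; ring

lemma In_rec {r : ℝ} (hr : 0 < r) : r ^ 2 * In 3 r - r * In 2 r - (1 + r ^ 2) * In 1 r = 0 := by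
  have hd : ∀ t ∈ Set.Ici (0:ℝ), HasDerivAt
      (fun t => -(Real.exp (-(r * Real.cosh t)) * (Real.sinh t * (r * Real.cosh t + 1))))
      (r ^ 2 * Kf 3 r t - r * Kf 2 r t - (1 + r ^ 2) * Kf 1 r t) t := by
    intro t _
    have h1 := ((Real.hasDerivAt_cosh t).const_mul r)
    have h2 := (h1.neg.exp.mul ((Real.hasDerivAt_sinh t).mul (h1.add_const 1))).neg
    refine h2.congr_deriv ?_
    unfold Kf
    have := Real.sinh_sq t
    simp only [Pi.mul_apply, Pi.neg_apply]
    linear_combination (r ^ 2 * Real.exp (-(r * Real.cosh t)) * Real.cosh t) * this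
  have hi : IntegrableOn (fun t => r ^ 2 * Kf 3 r t - r * Kf 2 r t - (1 + r ^ 2) * Kf 1 r t) (Set.Ioi 0) :=
    (((Kf_int 3 hr).const_mul _).sub ((Kf_int 2 hr).const_mul _)).sub ((Kf_int 1 hr).const_mul _)
  have hbd : ∀ n : ℕ, Tendsto (Kf n r) atTop (𝓝 0) := by
    intro n
    refine squeeze_zero (fun t => (Kf_pos n r t).le) (fun t => Kf_bd n hr t) ?_
    have h3 : Tendsto (fun t : ℝ => Real.exp (-(r / 2) * t)) atTop (𝓝 0) := by
      refine Real.tendsto_exp_atBot.comp ?_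
      exact tendsto_id.const_mul_atTop_of_neg (by linarith)
    have := h3.const_mul ((n.factorial : ℝ) * (2 / r) ^ n)
    rwa [mul_zero] at this
  have hlim : Tendsto
      (fun t => -(Real.exp (-(r * Real.cosh t)) * (Real.sinh t * (r * Real.cosh t + 1)))) atTop (𝓝 0) := by
    have h4 : Tendsto (fun t => r * Kf 2 r t + Kf 1 r t) atTop (𝓝 0) := by
      have := ((hbd 2).const_mul r).add (hbd 1)
      simpa using this
    refine squeeze_zero_norm' ?_ h4
    filter_upwards [eventually_ge_atTop 0] with t ht
    have hs : 0 ≤ Real.sinh t := Real.sinh_nonneg_iff.2 ht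
    have hc := Real.cosh_pos t
    have hsc := (Real.sinh_lt_cosh t).le
    rw [norm_neg, Real.norm_eq_abs, abs_of_nonneg (by positivity)]
    calc Real.exp (-(r * Real.cosh t)) * (Real.sinh t * (r * Real.cosh t + 1))
        ≤ Real.exp (-(r * Real.cosh t)) * (Real.cosh t * (r * Real.cosh t + 1)) := by gcongr
      _ = _ := by unfold Kf; ring
  have h := integral_Ioi_of_hasDerivAt_of_tendsto' hd hi hlim
  have hA : Integrable (fun t => r ^ 2 * Kf 3 r t - r * Kf 2 r t) (volume.restrict (Set.Ioi 0)) :=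
    ((Kf_int 3 hr).const_mul _).sub ((Kf_int 2 hr).const_mul _)
  rw [integral_sub hA ((Kf_int 1 hr).const_mul _),
    integral_sub ((Kf_int 3 hr).const_mul _) ((Kf_int 2 hr).const_mul _),
    integral_const_mul, integral_const_mul, integral_const_mul] at h
  simpa [In] using h

lemma K1_hasDeriv {r : ℝ} (hr : 0 < r) : HasDerivAt K1 (deriv K1 r) r := by
  rw [K1_eq]; exact (In_deriv 1 hr).differentiableAt.hasDerivAt

lemma K1_d1 {r : ℝ} (hr : 0 < r) : deriv K1 r = -In 2 r := by
  rw [K1_eq]; exact (In_deriv 1 hr).deriv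

lemma K1_pos {r : ℝ} (hr : 0 < r) : 0 < K1 r := by rw [K1_eq]; exact In_pos 1 hr

lemma K1_d1_neg {r : ℝ} (hr : 0 < r) : deriv K1 r < 0 := by
  rw [K1_d1 hr]; linarith [In_pos 2 hr]

lemma K1_ode {r : ℝ} (hr : 0 < r) :
    HasDerivAt (deriv K1) (K1 r / r ^ 2 + K1 r - deriv K1 r / r) r := by
  have h1 : HasDerivAt (fun r => -In 2 r) (In 3 r) r := (In_deriv 2 hr).neg.congr_deriv (by ring)
  have h2 : HasDerivAt (deriv K1) (In 3 r) r := by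
    refine h1.congr_of_eventuallyEq ?_
    filter_upwards [lt_mem_nhds hr] with s hs
    exact K1_d1 hs
  refine h2.congr_deriv ?_
  rw [K1_d1 hr, K1_eq]
  have := In_rec hr
  field_simp
  linarith

lemma K1_bracket {r : ℝ} (hr : 0 < r) : 0 < r ^ 2 * deriv K1 r ^ 2 - (1 + r ^ 2) * K1 r ^ 2 := by
  set G : ℝ → ℝ := fun r => r ^ 2 * deriv K1 r ^ 2 - (1 + r ^ 2) * K1 r ^ 2 with hG
  have hd : ∀ x : ℝ, 0 < x → HasDerivAt G (-(2 * x * K1 x ^ 2)) x := by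
    intro x hx
    have := (((hasDerivAt_pow 2 x).mul ((K1_ode hx).pow 2)).sub
      (((hasDerivAt_pow 2 x).const_add 1).mul ((K1_hasDeriv hx).pow 2)))
    refine this.congr_deriv ?_
    simp
    field_simp
    ring
  have hm : StrictAntiOn G (Set.Ioi 0) := by
    refine strictAntiOn_of_hasDerivWithinAt_neg (f' := fun x => -(2 * x * K1 x ^ 2)) (convex_Ioi 0) ?_ ?_ ?_
    · exact fun x hx => (hd x hx).continuousAt.continuousWithinAt
    · intro x hx
      rw [interior_Ioi] at hx
      exact (hd x hx).hasDerivWithinAt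
    · intro x hx
      rw [interior_Ioi] at hx
      have hx : 0 < x := hx
      have := K1_pos hx
      simp only [Left.neg_neg_iff]
      positivity
  have hlim : Tendsto G atTop (𝓝 0) := by
    have h1 := (In_tendsto 2 1).pow 2
    have h2 := (In_tendsto 1 0).pow 2
    have h3 := (In_tendsto 1 1).pow 2
    have h4 := h1.sub (h2.add h3)
    refine (h4.congr' ?_).trans (by simp)
    filter_upwards [eventually_gt_atTop 0] with x hx
    simp only [hG]
    rw [K1_d1 hx, K1_eq]
    ring
  have h1 : G (r + 1) < G r := hm hr (show (0:ℝ) < r + 1 by linarith) (by linarith)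
  have h2 : 0 ≤ G (r + 1) := by
    refine le_of_tendsto hlim ?_
    filter_upwards [eventually_ge_atTop (r + 1)] with x hx
    exact hm.antitoneOn (show (0:ℝ) < r + 1 by linarith) (show (0:ℝ) < x by linarith) hx
  change 0 < G r
  linarith

lemma K1_lt {r : ℝ} (hr : 0 < r) : r * deriv K1 r < -K1 r := by
  have h1 := K1_bracket hr
  have h2 := K1_pos hr
  have h3 := K1_d1_neg hr
  nlinarith [mul_pos hr h2, mul_pos hr (neg_pos.2 h3)]

/-- monotonicity of the dispersion function -/
lemma D_anti {κ t a : ℝ} (hκ : 0 < κ) (ht : 0 < t) (hta : t < a)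
    (hJ : ∀ r ∈ Set.Icc t a, J1 (κ * r) ≠ 0) :
    a * (deriv K1 a / K1 a + (1 / κ) * (deriv J1 (κ * a) / J1 (κ * a))) <
    t * (deriv K1 t / K1 t + (1 / κ) * (deriv J1 (κ * t) / J1 (κ * t))) := by
  set D : ℝ → ℝ := fun t => t * (deriv K1 t / K1 t + (1 / κ) * (deriv J1 (κ * t) / J1 (κ * t))) with hD
  have hd : ∀ r ∈ Set.Icc t a, ∃ d < 0, HasDerivAt D d r := by
    intro r hr
    have hr0 : 0 < r := lt_of_lt_of_le ht hr.1
    have hJr := hJ r hr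
    have hm : HasDerivAt (fun r : ℝ => κ * r) κ r :=
      ((hasDerivAt_id r).const_mul κ).congr_deriv (by simp)
    have hκr : 0 < κ * r := by positivity
    have hj1 := (J1_hasDeriv (κ * r)).comp r hm
    have hj2 := (J1_ode hκr.ne').comp r hm
    have hk := (K1_ode hr0).div (K1_hasDeriv hr0) (K1_pos hr0).ne'
    have hj := (hj2.div hj1 hJr).const_mul (1 / κ)
    refine ⟨_, ?_, (hasDerivAt_id r).mul (hk.add hj)⟩
    have b1 := K1_bracket hr0
    have b2 := J1_bracket hκr.le
    have hK := K1_pos hr0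
    simp only [Function.comp, id, Pi.add_apply, Pi.div_apply]
    generalize deriv K1 r = k1 at *
    generalize K1 r = k at *
    generalize deriv J1 (κ * r) = j1 at *
    generalize J1 (κ * r) = j at *
    have : 1 * (k1 / k + 1 / κ * (j1 / j)) + r * (((k / r ^ 2 + k - k1 / r) * k - k1 * k1) / k ^ 2 +
        1 / κ * (((j / (κ * r) ^ 2 - j - j1 / (κ * r)) * κ * j - j1 * (j1 * κ)) / j ^ 2)) =
        -((r ^ 2 * k1 ^ 2 - (1 + r ^ 2) * k ^ 2) / (r * k ^ 2)) -
        (((κ * r) ^ 2 * j1 ^ 2 + ((κ * r) ^ 2 - 1) * j ^ 2) / (κ ^ 2 * r * j ^ 2)) := by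
      field_simp
      ring
    rw [this]
    have c1 : 0 < (r ^ 2 * k1 ^ 2 - (1 + r ^ 2) * k ^ 2) / (r * k ^ 2) := by positivity
    have c2 : 0 ≤ ((κ * r) ^ 2 * j1 ^ 2 + ((κ * r) ^ 2 - 1) * j ^ 2) / (κ ^ 2 * r * j ^ 2) := by
      positivity
    linarith
  choose! d hd1 hd2 using hd
  have hm : StrictAntiOn D (Set.Icc t a) := by
    refine strictAntiOn_of_hasDerivWithinAt_neg (f' := d) (convex_Icc t a) ?_ ?_ ?_
    · exact fun x hx => (hd2 x hx).continuousAt.continuousWithinAt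
    · intro x hx
      exact (hd2 x (interior_subset hx)).hasDerivWithinAt
    · intro x hx
      exact hd1 x (interior_subset hx)
  exact hm (Set.left_mem_Icc.2 hta.le) (Set.right_mem_Icc.2 hta.le) hta


structure VS (lam W : ℝ) (V : ℝ → ℝ) : Prop where
  lam1 : 1 < lam
  W0 : 0 < W
  d1 : ∀ r, 0 < r → HasDerivAt V (deriv V r) r
  d2 : ∀ r, 0 < r → HasDerivAt (deriv V)
    (V r - lam * max (V r - W * r) 0 - deriv V r / r + V r / r ^ 2) r
  bd : ∃ M, ∀ r, 0 < r → |deriv V r| ≤ M ∧ |V r| ≤ M ∧ |V r| ≤ M * r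
  pos : ∀ r, 0 < r → 0 < V r
  lim : Tendsto V atTop (𝓝 0)
  anti : ∀ r s, 0 < r → r ≤ s → V s / s ≤ V r / r

section
variable {lam W : ℝ} {V : ℝ → ℝ}

lemma VS.slope (h : VS lam W V) {r : ℝ} (hr : 0 < r) : r * deriv V r - V r ≤ 0 := by
  by_contra hc
  push Not at hc
  have hd : HasDerivAt (fun r => V r / r) ((deriv V r * r - V r * 1) / r ^ 2) r :=
    (h.d1 r hr).div (hasDerivAt_id r) hr.ne'
  have hp : 0 < (deriv V r * r - V r * 1) / r ^ 2 := by
    apply div_pos _ (by positivity); linarith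
  have h1 := hd.tendsto_slope
  have h2 := h1.mono_left (nhdsWithin_mono r (show Set.Ioi r ⊆ {r}ᶜ from fun x hx => ne_of_gt hx))
  have h3 := h2.eventually (lt_mem_nhds hp)
  obtain ⟨s, hs, hs2⟩ := (h3.and self_mem_nhdsWithin).exists
  have hs2 : r < s := hs2
  rw [slope_def_field] at hs
  have := h.anti r s hr hs2.le
  have h4 : 0 < s - r := by linarith
  have := (div_pos_iff_of_pos_right h4).1 hs
  linarith

lemma tend_right_bd {f : ℝ → ℝ} {M : ℝ} {b : ℝ} (hb : 0 < b) (hf : ∀ r, 0 < r → r ≤ b → |f r| ≤ M * r) :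
    Tendsto f (𝓝[>] 0) (𝓝 0) := by
  have h1 : Tendsto (fun r : ℝ => M * r) (𝓝[>] 0) (𝓝 0) := by
    have : Continuous fun r : ℝ => M * r := by fun_prop
    have := this.tendsto 0
    rw [mul_zero] at this
    exact this.mono_left nhdsWithin_le_nhds
  refine squeeze_zero_norm' ?_ h1
  have h2 : ∀ᶠ r : ℝ in 𝓝[>] 0, r ≤ b := nhdsWithin_le_nhds (Iic_mem_nhds hb)
  filter_upwards [h2, self_mem_nhdsWithin] with r h2 h3
  exact hf r h3 h2

lemma VS.exceed (h : VS lam W V) : ∃ r, 0 < r ∧ W * r < V r := by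
  by_contra hc
  push Not at hc
  set S : ℝ → ℝ := fun r => r ^ 2 * deriv V r - r * V r with hS
  have hd : ∀ r, 0 < r → HasDerivAt S (r ^ 2 * V r) r := by
    intro r hr
    have h1 := ((hasDerivAt_pow 2 r).mul (h.d2 r hr)).sub ((hasDerivAt_id r).mul (h.d1 r hr))
    refine h1.congr_deriv ?_
    have : max (V r - W * r) 0 = 0 := max_eq_right (by linarith [hc r hr])
    rw [this]
    simp
    field_simp
    ring
  have hm : StrictMonoOn S (Set.Ioi 0) := by
    refine strictMonoOn_of_hasDerivWithinAt_pos (f' := fun r => r ^ 2 * V r) (convex_Ioi 0) ?_ ?_ ?_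
    · exact fun x hx => (hd x hx).continuousAt.continuousWithinAt
    · intro x hx
      rw [interior_Ioi] at hx
      exact (hd x hx).hasDerivWithinAt
    · intro x hx
      rw [interior_Ioi] at hx
      have hx : 0 < x := hx
      have := h.pos x hx
      positivity
  obtain ⟨M, hM⟩ := h.bd
  have hM0 : 0 ≤ M := (abs_nonneg _).trans (hM 1 one_pos).1
  have hlim : Tendsto S (𝓝[>] 0) (𝓝 0) := by
    refine tend_right_bd (M := 2 * M) one_pos fun r hr hr1 => ?_
    obtain ⟨b1, b2, b3⟩ := hM r hr
    rw [abs_le] at *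
    have : r ^ 2 ≤ r := by nlinarith
    simp only [hS]
    constructor <;> nlinarith [mul_nonneg hr.le hM0, sq_nonneg r]
  have h1 : S (1 / 2) < S 1 := hm (show (0:ℝ) < 1 / 2 by norm_num) (show (0:ℝ) < 1 by norm_num) (by norm_num)
  have h2 : 0 ≤ S (1 / 2) := by
    refine le_of_tendsto hlim ?_
    have h2 : ∀ᶠ r : ℝ in 𝓝[>] 0, r ≤ 1 / 2 := nhdsWithin_le_nhds (Iic_mem_nhds (by norm_num))
    filter_upwards [h2, self_mem_nhdsWithin] with r h2 h3
    exact hm.monotoneOn h3 (show (0:ℝ) < 1 / 2 by norm_num) h2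
  have h3 := h.slope one_pos
  have : S 1 = 1 * deriv V 1 - V 1 := by simp [hS]
  linarith

lemma VS.exists_a (h : VS lam W V) : ∃ a, 0 < a ∧ (∀ r, 0 < r → r ≤ a → W * r ≤ V r) ∧
    (∀ r, a ≤ r → V r ≤ W * r) := by
  obtain ⟨r0, hr0, hr0'⟩ := h.exceed
  set T : Set ℝ := {r | 0 < r ∧ W * r < V r} with hT
  have hW := h.W0
  have hbdd : BddAbove T := by
    have h1 : ∀ᶠ r in atTop, V r < W := h.lim.eventually (gt_mem_nhds hW)
    obtain ⟨R, hR⟩ := (h1.and (eventually_ge_atTop 1)).exists_forall_of_atTop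
    refine ⟨R, fun r hr => ?_⟩
    by_contra hc
    push Not at hc
    obtain ⟨b1, b2⟩ := hR r hc.le
    have := hr.2
    nlinarith
  have hr0T : r0 ∈ T := ⟨hr0, hr0'⟩
  have ha : 0 < sSup T := lt_of_lt_of_le hr0 (le_csSup hbdd hr0T)
  have hlt : ∀ r, 0 < r → r < sSup T → W * r < V r := by
    intro r hr hra
    obtain ⟨s, hs, hrs⟩ := exists_lt_of_lt_csSup ⟨r0, hr0T⟩ hra
    have h1 := h.anti r s hr hrs.le
    have h2 : W < V s / s := by rw [lt_div_iff₀ hs.1]; exact hs.2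
    have h3 : W < V r / r := lt_of_lt_of_le h2 h1
    rwa [lt_div_iff₀ hr] at h3
  have hgt : ∀ r, sSup T < r → V r ≤ W * r := by
    intro r hr
    by_contra hc
    push Not at hc
    have := le_csSup hbdd (show r ∈ T from ⟨ha.trans hr, hc⟩)
    linarith
  have hcont : ContinuousAt (fun r => V r - W * r) (sSup T) :=
    (h.d1 _ ha).continuousAt.sub (by fun_prop)
  refine ⟨sSup T, ha, ?_, ?_⟩
  · intro r hr hra
    rcases hra.eq_or_lt with h0 | h0
    · rw [h0]
      have : 0 ≤ V (sSup T) - W * sSup T := by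
        refine ge_of_tendsto (hcont.tendsto.mono_left (nhdsWithin_le_nhds (s := Set.Iio (sSup T)))) ?_
        have h2 : ∀ᶠ r : ℝ in 𝓝[<] (sSup T), 0 < r := nhdsWithin_le_nhds (lt_mem_nhds ha)
        filter_upwards [h2, self_mem_nhdsWithin] with r h2 h3
        linarith [hlt r h2 h3]
      linarith
    · exact (hlt r hr h0).le
  · intro r hra
    rcases hra.eq_or_lt with h0 | h0
    · rw [← h0]
      have : V (sSup T) - W * sSup T ≤ 0 := by
        refine le_of_tendsto (hcont.tendsto.mono_left (nhdsWithin_le_nhds (s := Set.Ioi (sSup T)))) ?_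
        filter_upwards [self_mem_nhdsWithin] with r h3
        linarith [hgt r h3]
      linarith
    · exact hgt r h0

lemma const_of_deriv0 {f : ℝ → ℝ} {a b : ℝ} (hab : a ≤ b)
    (hf : ∀ x ∈ Set.Icc a b, HasDerivAt f 0 x) : f b = f a :=
  constant_of_has_deriv_right_zero (fun x hx => (hf x hx).continuousAt.continuousWithinAt)
    (fun x hx => (hf x ⟨hx.1, hx.2.le⟩).hasDerivWithinAt) b (Set.right_mem_Icc.2 hab)

/-- outside -/
lemma VS.outside (h : VS lam W V) {a : ℝ} (ha : 0 < a) (hout : ∀ r, a ≤ r → V r ≤ W * r) :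
    deriv V a = V a / K1 a * deriv K1 a ∧ ∀ r, a ≤ r → V r = V a / K1 a * K1 r := by
  set w : ℝ → ℝ := fun r => r * (V r * deriv K1 r - deriv V r * K1 r) with hw
  have hd : ∀ r, a ≤ r → HasDerivAt w 0 r := by
    intro r har
    have hr : 0 < r := lt_of_lt_of_le ha har
    have h1 := (hasDerivAt_id r).mul (((h.d1 r hr).mul (K1_ode hr)).sub ((h.d2 r hr).mul (K1_hasDeriv hr)))
    refine h1.congr_deriv ?_
    have : max (V r - W * r) 0 = 0 := max_eq_right (by linarith [hout r har])
    rw [this]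
    simp
    field_simp
    ring
  have hwc : ∀ r s, a ≤ r → r ≤ s → w s = w r := fun r s h1 h2 =>
    const_of_deriv0 h2 fun x hx => hd x (h1.trans hx.1)
  obtain ⟨M, hM⟩ := h.bd
  have hlim : Tendsto w atTop (𝓝 0) := by
    have h1 := (((In_tendsto 2 1).const_mul M).add ((In_tendsto 1 1).const_mul M))
    simp only [mul_zero, add_zero] at h1
    refine squeeze_zero_norm' ?_ h1
    filter_upwards [eventually_gt_atTop 0] with r hr
    obtain ⟨b1, b2, -⟩ := hM r hr
    have p1 := In_pos 1 hr
    have p2 := In_pos 2 hr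
    rw [hw, Real.norm_eq_abs]
    simp only
    rw [K1_d1 hr, K1_eq, abs_mul, abs_of_pos hr]
    calc r * |V r * -In 2 r - deriv V r * In 1 r| ≤ r * (|V r| * In 2 r + |deriv V r| * In 1 r) := by
          gcongr
          refine (abs_sub _ _).trans ?_
          rw [abs_mul, abs_mul, abs_neg, abs_of_pos p1, abs_of_pos p2]
      _ ≤ r * (M * In 2 r + M * In 1 r) := by gcongr
      _ = _ := by ring
  have hw0 : ∀ r, a ≤ r → w r = 0 := by
    intro r hr
    have : Tendsto w atTop (𝓝 (w r)) := by
      refine tendsto_const_nhds.congr' ?_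
      filter_upwards [eventually_ge_atTop r] with s hs
      exact (hwc r s hr hs).symm
    exact tendsto_nhds_unique this hlim
  have hV' : ∀ r, a ≤ r → V r * deriv K1 r - deriv V r * K1 r = 0 := by
    intro r hr
    rcases mul_eq_zero.1 (hw0 r hr) with h1 | h1
    · linarith
    · exact h1
  constructor
  · have := hV' a le_rfl
    have hK := K1_pos ha
    field_simp
    linarith
  · intro r har
    have hq := const_of_deriv0 (f := fun r => V r / K1 r) har (fun x hx => by
      have hx0 : 0 < x := lt_of_lt_of_le ha hx.1
      refine ((h.d1 x hx0).div (K1_hasDeriv hx0) (K1_pos hx0).ne').congr_deriv ?_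
      rw [show deriv V x * K1 x - V x * deriv K1 x = 0 by linarith [hV' x hx.1]]
      simp)
    have hK := K1_pos (lt_of_lt_of_le ha har)
    rw [← hq]
    field_simp

lemma lin_unique {z z' : ℝ → ℝ} {κ r0 a : ℝ} (hr0 : 0 < r0) 
    (h1 : ∀ r ∈ Set.Icc r0 a, HasDerivAt z (z' r) r)
    (h2 : ∀ r ∈ Set.Icc r0 a, HasDerivAt z' (-κ ^ 2 * z r - z' r / r + z r / r ^ 2) r)
    (z0 : z r0 = 0) (z0' : z' r0 = 0) : ∀ r ∈ Set.Icc r0 a, z r = 0 ∧ z' r = 0 := by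
  set C : ℝ := 1 + κ ^ 2 + 1 / r0 ^ 2 with hC
  set F : ℝ → ℝ := fun r => (z r ^ 2 + z' r ^ 2) * Real.exp (-C * r) with hF
  have hd : ∀ r ∈ Set.Icc r0 a, HasDerivAt F
      ((2 * z r * z' r + 2 * z' r * (-κ ^ 2 * z r - z' r / r + z r / r ^ 2) -
        C * (z r ^ 2 + z' r ^ 2)) * Real.exp (-C * r)) r := by
    intro r hr
    have he : HasDerivAt (fun r => Real.exp (-C * r)) (Real.exp (-C * r) * (-C)) r :=
      (((hasDerivAt_id r).const_mul (-C)).congr_deriv (by simp)).exp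
    refine ((((h1 r hr).pow 2).add ((h2 r hr).pow 2)).mul he).congr_deriv ?_
    simp
    ring
  have hm : AntitoneOn F (Set.Icc r0 a) := by
    refine antitoneOn_of_hasDerivWithinAt_nonpos (convex_Icc r0 a)
      (fun x hx => (hd x hx).continuousAt.continuousWithinAt)
      (fun x hx => (hd x (interior_subset hx)).hasDerivWithinAt) ?_
    intro x hx
    have hx := interior_subset hx
    have hx0 : 0 < x := lt_of_lt_of_le hr0 hx.1
    refine mul_nonpos_of_nonpos_of_nonneg ?_ (Real.exp_pos _).le
    have hi : 1 / x ^ 2 ≤ 1 / r0 ^ 2 := by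
      have := hx.1
      gcongr
    have hp : 0 ≤ 1 / x ^ 2 := by positivity
    have hq : 0 ≤ z' x ^ 2 / x := by positivity
    have hab1 : 2 * (z x * z' x) ≤ z x ^ 2 + z' x ^ 2 := by nlinarith [sq_nonneg (z x - z' x)]
    have hab2 : -(2 * (z x * z' x)) ≤ z x ^ 2 + z' x ^ 2 := by nlinarith [sq_nonneg (z x + z' x)]
    have e1 : 2 * z x * z' x + 2 * z' x * (-κ ^ 2 * z x - z' x / x + z x / x ^ 2) -
        C * (z x ^ 2 + z' x ^ 2) = (2 * (z x * z' x) - (z x ^ 2 + z' x ^ 2)) +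
        κ ^ 2 * (-(2 * (z x * z' x)) - (z x ^ 2 + z' x ^ 2)) +
        1 / x ^ 2 * (2 * (z x * z' x) - (z x ^ 2 + z' x ^ 2)) - 2 * (z' x ^ 2 / x)
        - (1 / r0 ^ 2 - 1 / x ^ 2) * (z x ^ 2 + z' x ^ 2) := by
      rw [hC]; ring
    rw [e1]
    have t2 : κ ^ 2 * (-(2 * (z x * z' x)) - (z x ^ 2 + z' x ^ 2)) ≤ 0 :=
      mul_nonpos_of_nonneg_of_nonpos (sq_nonneg _) (by linarith)
    have t3 : 1 / x ^ 2 * (2 * (z x * z' x) - (z x ^ 2 + z' x ^ 2)) ≤ 0 :=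
      mul_nonpos_of_nonneg_of_nonpos hp (by linarith)
    have t4 : 0 ≤ (1 / r0 ^ 2 - 1 / x ^ 2) * (z x ^ 2 + z' x ^ 2) :=
      mul_nonneg (by linarith) (by positivity)
    linarith
  intro r hr
  have h3 := hm (Set.left_mem_Icc.2 (hr.1.trans hr.2)) hr hr.1
  have h4 : F r0 = 0 := by simp [hF, z0, z0']
  rw [h4] at h3
  have h5 : z r ^ 2 + z' r ^ 2 ≤ 0 := by
    by_contra hc
    push Not at hc
    have := mul_pos hc (Real.exp_pos (-C * r))
    simp only [hF] at h3
    linarith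
  constructor <;> nlinarith [sq_nonneg (z r), sq_nonneg (z' r)]

/-- inside -/
lemma VS.inside (h : VS lam W V) {a : ℝ} (ha : 0 < a) (hin : ∀ r, 0 < r → r ≤ a → W * r ≤ V r) :
    ∃ A, ∀ r, 0 < r → r ≤ a → V r = A * J1 (√(lam - 1) * r) + W * lam / (lam - 1) * r ∧
      deriv V r = A * (√(lam - 1) * deriv J1 (√(lam - 1) * r)) + W * lam / (lam - 1) := by
  have hl : 0 < lam - 1 := by linarith [h.lam1]
  set κ := √(lam - 1) with hκ
  have hκ0 : 0 < κ := Real.sqrt_pos.2 hl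
  have hκ2 : κ ^ 2 = lam - 1 := Real.sq_sqrt hl.le
  set m := W * lam / (lam - 1) with hm
  have hmm : κ ^ 2 * m = lam * W := by rw [hκ2, hm]; field_simp
  set j : ℝ → ℝ := fun r => J1 (κ * r) with hj
  set j' : ℝ → ℝ := fun r => κ * deriv J1 (κ * r) with hj'
  have hml : ∀ r : ℝ, HasDerivAt (fun r : ℝ => κ * r) κ r := fun r =>
    ((hasDerivAt_id r).const_mul κ).congr_deriv (by simp)
  have hj1 : ∀ r, HasDerivAt j (j' r) r := fun r =>
    ((J1_hasDeriv (κ * r)).comp r (hml r)).congr_deriv (by simp [hj']; ring)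
  have hj2 : ∀ r, 0 < r → HasDerivAt j' (-κ ^ 2 * j r - j' r / r + j r / r ^ 2) r := by
    intro r hr
    have hκr : κ * r ≠ 0 := by positivity
    refine (((J1_ode hκr).comp r (hml r)).const_mul κ).congr_deriv ?_
    simp only [hj, hj']
    field_simp
    ring
  set Y : ℝ → ℝ := fun r => V r - m * r with hY
  set Y' : ℝ → ℝ := fun r => deriv V r - m with hY'
  have hY1 : ∀ r, 0 < r → HasDerivAt Y (Y' r) r := fun r hr =>
    ((h.d1 r hr).sub ((hasDerivAt_id r).const_mul m)).congr_deriv (by simp [hY'])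
  have hY2 : ∀ r, 0 < r → r ≤ a → HasDerivAt Y' (-κ ^ 2 * Y r - Y' r / r + Y r / r ^ 2) r := by
    intro r hr hra
    refine ((h.d2 r hr).sub_const m).congr_deriv ?_
    rw [max_eq_left (by linarith [hin r hr hra])]
    simp only [hY, hY']
    have : lam = κ ^ 2 + 1 := by linarith
    have e : lam * (V r - W * r) = (κ ^ 2 + 1) * V r - κ ^ 2 * m * r := by
      rw [hmm, ← this]; ring
    rw [e]
    field_simp
    ring
  set w : ℝ → ℝ := fun r => r * (Y r * j' r - Y' r * j r) with hw
  have hwd : ∀ r, 0 < r → r ≤ a → HasDerivAt w 0 r := by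
    intro r hr hra
    refine ((hasDerivAt_id r).mul (((hY1 r hr).mul (hj2 r hr)).sub ((hY2 r hr hra).mul (hj1 r)))).congr_deriv ?_
    simp
    field_simp
    ring
  have hw0 : ∀ r, 0 < r → r ≤ a → w r = 0 := by
    obtain ⟨M, hM⟩ := h.bd
    have hM0 : 0 ≤ M := (abs_nonneg _).trans (hM 1 one_pos).1
    have hjc : Continuous j := continuous_iff_continuousAt.2 fun r => (hj1 r).continuousAt
    have hlim : Tendsto w (𝓝[>] 0) (𝓝 0) := by
      have hYb : Tendsto (fun r => r * Y r) (𝓝[>] 0) (𝓝 0) := by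
        refine tend_right_bd (M := M + |m| * 1) one_pos fun r hr hr1 => ?_
        rw [abs_mul, abs_of_pos hr, mul_comm]
        gcongr
        refine (abs_sub _ _).trans ?_
        rw [abs_mul, abs_of_pos hr]
        gcongr
        exact (hM r hr).2.1
      have hYb' : Tendsto (fun r => r * Y' r) (𝓝[>] 0) (𝓝 0) := by
        refine tend_right_bd (M := M + |m|) one_pos fun r hr hr1 => ?_
        rw [abs_mul, abs_of_pos hr, mul_comm]
        gcongr
        refine (abs_sub _ _).trans ?_
        gcongr
        exact (hM r hr).1
      have hjl : Tendsto j (𝓝[>] 0) (𝓝 (j 0)) := (hjc.tendsto 0).mono_left nhdsWithin_le_nhds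
      have hd1 : Continuous (deriv J1) := by
        have hS : ∀ c : ℕ → ℝ, (∀ k, |c k| ≤ 1 / (k.factorial : ℝ)) → Continuous (Ser c) :=
          fun c hc => continuous_iff_continuousAt.2 fun s => (Ser_deriv hc s).continuousAt
        have : deriv J1 = fun s => Ser jc (s ^ 2 / 4) / 2 + s ^ 2 / 4 * Ser (Dc jc) (s ^ 2 / 4) :=
          funext fun s => (J1_d1 s).deriv
        rw [this]
        have a1 := hS _ jc_bd
        have a2 := hS _ (Dc_bd jc_bd)
        fun_prop
      have hj'c : Continuous j' := by rw [hj']; fun_prop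
      have hjl' : Tendsto j' (𝓝[>] 0) (𝓝 (j' 0)) := (hj'c.tendsto 0).mono_left nhdsWithin_le_nhds
      have := (hYb.mul hjl').sub (hYb'.mul hjl)
      rw [zero_mul, zero_mul, sub_zero] at this
      refine this.congr fun r => ?_
      simp only [hw]; ring
    intro r hr hra
    have : Tendsto w (𝓝[>] 0) (𝓝 (w r)) := by
      refine tendsto_const_nhds.congr' ?_
      have h2 : ∀ᶠ s : ℝ in 𝓝[>] 0, s ≤ r := nhdsWithin_le_nhds (Iic_mem_nhds hr)
      filter_upwards [h2, self_mem_nhdsWithin] with s h2 h3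
      have h3 : 0 < s := h3
      exact const_of_deriv0 h2 fun x hx => hwd x (lt_of_lt_of_le h3 hx.1) (hx.2.trans hra)
    exact tendsto_nhds_unique this hlim
  -- small interval with j ≠ 0
  obtain ⟨ε, hε, hεa, hεj⟩ : ∃ ε, 0 < ε ∧ ε ≤ a ∧ ∀ r, 0 < r → r ≤ ε → j r ≠ 0 := by
    have hd0 : HasDerivAt j (κ * (1 / 2)) 0 := by
      have := hj1 0
      simpa [hj', J1_d1_zero] using this
    have hev : ∀ᶠ r in 𝓝[≠] 0, j r ≠ 0 := by
      have := hd0.eventually_ne (c := 0) (by positivity)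
      exact this
    rw [eventually_nhdsWithin_iff, Metric.eventually_nhds_iff] at hev
    obtain ⟨δ, hδ, H⟩ := hev
    refine ⟨min (δ / 2) a, by positivity, min_le_right _ _, fun r hr hr2 => ?_⟩
    refine H ?_ hr.ne'
    rw [Real.dist_eq, sub_zero, abs_of_pos hr]
    have := hr2.trans (min_le_left _ _)
    linarith
  have hloc : ∀ r0, 0 < r0 → r0 ≤ ε → ∀ r ∈ Set.Icc r0 a,
      Y r = Y r0 / j r0 * j r ∧ Y' r = Y r0 / j r0 * j' r := by
    intro r0 hr0 hr0ε r hr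
    have hjr0 := hεj r0 hr0 hr0ε
    have hw1 : Y r0 * j' r0 - Y' r0 * j r0 = 0 := by
      rcases mul_eq_zero.1 (hw0 r0 hr0 (hr0ε.trans hεa)) with h1 | h1
      · linarith
      · exact h1
    have := lin_unique (z := fun r => Y r - Y r0 / j r0 * j r)
      (z' := fun r => Y' r - Y r0 / j r0 * j' r) (κ := κ) (a := a) hr0
      (fun r hr => (hY1 r (lt_of_lt_of_le hr0 hr.1)).sub ((hj1 r).const_mul _))
      (fun r hr => ((hY2 r (lt_of_lt_of_le hr0 hr.1) hr.2).sub
        ((hj2 r (lt_of_lt_of_le hr0 hr.1)).const_mul _)).congr_deriv (by ring))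
      (by field_simp; ring) (by field_simp; linarith) r hr
    exact ⟨by linarith [this.1], by linarith [this.2]⟩
  refine ⟨Y ε / j ε, fun r hr hra => ?_⟩
  have hr0 : 0 < min r ε := lt_min hr hε
  have hA : Y (min r ε) / j (min r ε) = Y ε / j ε := by
    have := (hloc _ hr0 (min_le_right _ _) ε ⟨min_le_right _ _, hεa⟩).1
    rw [this]
    have := hεj ε hε le_rfl
    field_simp
  have := hloc _ hr0 (min_le_right _ _) r ⟨min_le_left _ _, hra⟩
  rw [hA] at this
  simp only [hY, hY'] at this ⊢
  exact ⟨by linarith [this.1], by linarith [this.2]⟩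

lemma VS.main (h : VS lam W V) : 0 < aLam lam ∧
    (∀ r, 0 < r → r ≤ aLam lam →
      V r = (-(W * aLam lam / (lam - 1)) / J1 (√(lam - 1) * aLam lam)) *
        J1 (√(lam - 1) * r) + (W * lam / (lam - 1)) * r) ∧
    (∀ r, aLam lam ≤ r → V r = (W * aLam lam / K1 (aLam lam)) * K1 r) := by
  obtain ⟨a, ha, hin, hout⟩ := h.exists_a
  have hVa : V a = W * a := le_antisymm (hout a le_rfl) (hin a ha le_rfl)
  obtain ⟨hd, ho⟩ := h.outside ha hout
  obtain ⟨A, hA⟩ := h.inside ha hin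
  have hl : 0 < lam - 1 := by linarith [h.lam1]
  have hW := h.W0
  set κ := √(lam - 1) with hκ
  have hκ0 : 0 < κ := Real.sqrt_pos.2 hl
  have hκ2 : κ ^ 2 = lam - 1 := Real.sq_sqrt hl.le
  have hAJ : A * J1 (κ * a) = -(W * a / (lam - 1)) := by
    have := (hA a ha le_rfl).1
    rw [hVa] at this
    field_simp at this ⊢
    linarith
  have hAJ0 : A * J1 (κ * a) ≠ 0 := by
    rw [hAJ]; have : 0 < W * a / (lam - 1) := by positivity
    linarith
  have hJa : J1 (κ * a) ≠ 0 := right_ne_zero_of_mul hAJ0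
  have hA0 : A ≠ 0 := left_ne_zero_of_mul hAJ0
  have hAeq : A = -(W * a / (lam - 1)) / J1 (κ * a) := by rw [eq_div_iff hJa, hAJ]
  have hKa := K1_pos ha
  have haS : a ∈ aSet lam := by
    refine ⟨ha, hJa, ?_⟩
    have h1 := (hA a ha le_rfl).2
    rw [hd, hVa, hAeq, ← hκ2] at h1
    rw [← hκ, ← hκ2]
    generalize deriv K1 a = k1 at *
    generalize K1 a = k at *
    generalize deriv J1 (κ * a) = j1 at *
    generalize J1 (κ * a) = j at *
    field_simp at h1 ⊢
    linarith
  have hmin : ∀ t ∈ aSet lam, a ≤ t := by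
    intro t ht
    by_contra hta
    push Not at hta
    obtain ⟨ht0, hJt, heq⟩ := ht
    rw [← hκ] at hJt heq
    have hKt := K1_pos ht0
    have hk : t * (deriv K1 t / K1 t) < -1 := by
      have := K1_lt ht0
      rw [← mul_div_assoc, div_lt_iff₀ hKt]
      linarith
    have hh : 1 < κ * t * (deriv J1 (κ * t) / J1 (κ * t)) := by
      have e1 : t * (1 / κ * (deriv J1 (κ * t) / J1 (κ * t))) =
        κ * t * (deriv J1 (κ * t) / J1 (κ * t)) / κ ^ 2 := by field_simp
      have e2 : lam / (lam - 1) = 1 + 1 / κ ^ 2 := by rw [hκ2]; field_simp; ring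
      rw [mul_add, e1, e2] at heq
      have h3 : 1 / κ ^ 2 < κ * t * (deriv J1 (κ * t) / J1 (κ * t)) / κ ^ 2 := by linarith
      exact (div_lt_div_iff_of_pos_right (by positivity)).1 h3
    have hsl := h.slope ht0
    obtain ⟨v1, v2⟩ := hA t ht0 hta.le
    have hprod : (A * J1 (κ * t)) * (κ * t * (deriv J1 (κ * t) / J1 (κ * t)) - 1) ≤ 0 := by
      have : (A * J1 (κ * t)) * (κ * t * (deriv J1 (κ * t) / J1 (κ * t)) - 1) =
        t * deriv V t - V t := by
        rw [v1, v2]; field_simp; ring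
      linarith
    have hneg : A * J1 (κ * t) < 0 := by
      have hne : A * J1 (κ * t) ≠ 0 := mul_ne_zero hA0 hJt
      rcases lt_or_gt_of_ne hne with h1 | h1
      · exact h1
      · have := mul_pos h1 (sub_pos.2 hh)
        linarith
    have hJne : ∀ r ∈ Set.Icc t a, J1 (κ * r) ≠ 0 := by
      intro r hr h0
      have hr0 : 0 < r := lt_of_lt_of_le ht0 hr.1
      have h1 := h.anti t r ht0 hr.1
      rw [v1, (hA r hr0 hr.2).1, h0, add_div, add_div, mul_div_cancel_right₀ _ hr0.ne',
        mul_div_cancel_right₀ _ ht0.ne'] at h1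
      have h2 : A * J1 (κ * t) / t < 0 := div_neg_of_neg_of_pos hneg ht0
      simp at h1
      linarith
    have := D_anti hκ0 ht0 hta hJne
    have h5 := haS.2.2
    rw [← hκ] at h5
    linarith
  have haL : aLam lam = a := IsLeast.csInf_eq ⟨haS, fun t ht => hmin t ht⟩
  rw [haL]
  refine ⟨ha, fun r hr hra => ?_, fun r har => ?_⟩
  · rw [← hAeq]; exact (hA r hr hra).1
  · rw [ho r har, hVa]
end


lemma sqrt_quot1 {g : ℝ → ℝ} {r : ℝ} (hr : 0 < r) (hgt : HasDerivAt g (deriv g r) r) :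
    deriv (fun t => g (√t) / √t) (r ^ 2) = (deriv g r / 2 - g r / (2 * r)) / r ^ 2 := by
  have ht : (0:ℝ) < r ^ 2 := by positivity
  have hs := Real.hasDerivAt_sqrt ht.ne'
  have e : √(r ^ 2) = r := Real.sqrt_sq hr.le
  rw [← e] at hgt
  have := (hgt.comp (r ^ 2) hs).div hs (by rw [e]; exact hr.ne')
  have h2 := this.deriv
  simp only [Function.comp, e] at h2
  have h3 : (((fun x => g (√x)) / fun x => √x) : ℝ → ℝ) = fun t => g (√t) / √t := rfl
  rw [← h3, show (fun x => g (√x)) = g ∘ fun x => √x from rfl] 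
  refine Eq.trans h2 ?_
  field_simp

lemma Hyp.VS {lam W : ℝ} {ψ : ℝ × ℝ → ℝ} (h : Hyp lam W ψ) {c : ℝ} {U : ℝ → ℝ}
    (hU : AntitoneOn U (Set.Ici 0))
    (hr : ∀ x y : ℝ, 0 < y → ψ (x, y) = y * U (rad (x + c, y))) :
    VS lam W (fun r => ψ (-c, r)) := by
  have hVU : ∀ r, 0 < r → ψ (-c, r) = r * U r := by
    intro r h0
    rw [hr _ _ h0]
    congr 2
    simp [rad, Real.sqrt_sq h0.le]
  have hc2 : ∀ r, 0 < r → ContDiffAt ℝ 2 (fun t => ψ (-c, t)) r := fun r h0 => h.c2_2 h0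
  have hd1 : ∀ r, 0 < r → HasDerivAt (fun t => ψ (-c, t)) (deriv (fun t => ψ (-c, t)) r) r :=
    fun r h0 => ((hc2 r h0).differentiableAt (by norm_num)).hasDerivAt
  refine ⟨h.lam1, h.W0, hd1, ?_, ?_, fun r h0 => h.pos _ h0, ?_, ?_⟩
  · intro r h0
    obtain ⟨-, h2⟩ := c2_hasDeriv (hc2 r h0)
    refine h2.congr_deriv ?_
    have hp := h.pde (-c, r) h0
    simp only [lap] at hp
    set V : ℝ → ℝ := fun t => ψ (-c, t) with hV
    set F : ℝ → ℝ := fun z => V (√z) / √z with hF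
    have e : √(r ^ 2) = r := Real.sqrt_sq h0.le
    have hFc : ContDiffAt ℝ 2 F (r ^ 2) := by
      have hs : ContDiffAt ℝ 2 (fun z : ℝ => √z) (r ^ 2) :=
        Real.contDiffAt_sqrt (by positivity)
      have hv : ContDiffAt ℝ 2 (fun z => V (√z)) (r ^ 2) := by
        refine ContDiffAt.comp (r ^ 2) (g := V) (f := fun z : ℝ => √z) ?_ hs
        simp only [e]
        exact hc2 r h0
      exact hv.div hs (by rw [e]; exact h0.ne')
    have hl := line_comp F (r ^ 2) 0 1 hFc
    have e1 : (fun t => ψ (t - c, r)) = fun t => r * F (r ^ 2 + t * 0 + t ^ 2 * 1) := by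
      funext t
      have hq : 0 < √(r ^ 2 + t ^ 2) := by positivity
      have hVU' := hVU _ hq
      rw [hr _ _ h0]
      simp only [hF, hV, mul_zero, add_zero, mul_one]
      rw [hVU']
      have : rad (t - c + c, r) = √(r ^ 2 + t ^ 2) := by
        simp [rad, add_comm]
      rw [this]
      field_simp
    have e2 : deriv (deriv fun t => ψ (t, r)) (-c) = r * (2 * deriv F (r ^ 2)) := by
      have a1 : deriv (fun t => ψ (t - c, r)) = fun t => deriv (fun t => ψ (t, r)) (t - c) := by
        funext t
        exact deriv_comp_sub_const (f := fun t => ψ (t, r)) (a := c) (x := t)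
      have a2 : deriv (deriv (fun t => ψ (t - c, r))) 0 = deriv (deriv fun t => ψ (t, r)) (-c) := by
        rw [a1, deriv_comp_sub_const (f := deriv fun t => ψ (t, r)) (a := c) (x := 0)]
        simp
      rw [← a2, e1]
      have a3 : deriv (fun t => r * F (r ^ 2 + t * 0 + t ^ 2 * 1)) =
          fun t => r * deriv (fun t => F (r ^ 2 + t * 0 + t ^ 2 * 1)) t := by
        funext t
        exact deriv_const_mul_field r
      rw [a3, deriv_const_mul_field, hl]
      ring
    rw [e2, sqrt_quot1 h0 (hd1 r h0)] at hp
    have : r * (2 * ((deriv V r / 2 - V r / (2 * r)) / r ^ 2)) = deriv V r / r - V r / r ^ 2 := by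
      field_simp
    rw [this] at hp
    change -(_ + deriv (deriv V) r) + V r = lam * max (V r - W * r) 0 at hp
    linarith
  · obtain ⟨M, hM⟩ := h.Pd_bdd
    obtain ⟨N, hN⟩ := h.bdd 0 (by norm_num)
    refine ⟨max M N, fun r h0 => ⟨?_, ?_, ?_⟩⟩
    · rw [(h.Pd_deriv h0).deriv]
      exact (hM _ h0.le).trans (le_max_left _ _)
    · have := hN (-c, r) (by rw [closure_UHP]; exact h0.le)
      rw [norm_iteratedFDerivWithin_zero] at this
      exact this.trans (le_max_right _ _)
    · obtain ⟨ξ, x0, x1, hx⟩ := h.mvt (-c) h0.le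
      have h3 : ψ (-c, r) / r = Pd ψ (-c, ξ) := by
        rw [← hx]; simp [ph, h0.ne']
      have h4 := hM (-c, ξ) x0
      rw [← h3, abs_div, abs_of_pos h0, div_le_iff₀ h0] at h4
      exact h4.trans (mul_le_mul_of_nonneg_right (le_max_left _ _) h0.le)
  · rw [Metric.tendsto_atTop]
    intro ε he
    obtain ⟨R, hR⟩ := h.decay (ε / 2) (by positivity)
    refine ⟨max R 1, fun r h1 => ?_⟩
    have h0 : 0 < r := lt_of_lt_of_le one_pos ((le_max_right _ _).trans h1)
    have := hR (-c, r) (by rw [closure_UHP]; exact h0.le) (by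
      refine ((le_max_left _ _).trans h1).trans ?_
      apply Real.le_sqrt_of_sq_le
      simp only
      nlinarith [sq_nonneg c])
    rw [Real.dist_eq, sub_zero]
    linarith
  · intro r s h0 hrs
    have hs := lt_of_lt_of_le h0 hrs
    simp only [hVU r h0, hVU s hs]
    rw [mul_div_cancel_left₀ _ h0.ne', mul_div_cancel_left₀ _ hs.ne']
    exact hU h0.le hs.le hrs

lemma Hyp.final {lam W : ℝ} {ψ : ℝ × ℝ → ℝ} (h : Hyp lam W ψ) :
    ∃ c : ℝ, ∀ x ∈ closure UHP, ψ x = PsiL lam W (x + (c, 0)) := by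
  obtain ⟨c, U, hU, -, hr⟩ := h.radial
  obtain ⟨ha, h1, h2⟩ := (h.VS hU hr).main
  refine ⟨c, ?_⟩
  rintro ⟨x, y⟩ hx
  rw [closure_UHP] at hx
  have hy : 0 ≤ y := hx
  have hadd : ((x, y) : ℝ × ℝ) + (c, 0) = (x + c, y) := by simp
  rw [hadd]
  rcases hy.eq_or_lt with h0 | h0
  · subst h0
    rw [h.bc]
    simp [PsiL]
  · have hρ : 0 < rad (x + c, y) := by unfold rad; positivity
    have hV : ψ (-c, rad (x + c, y)) = rad (x + c, y) * U (rad (x + c, y)) := by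
      rw [hr _ _ hρ]
      congr 2
      generalize rad (x + c, y) = ρ at *
      simp [rad, Real.sqrt_sq hρ.le]
    have e : ψ (x, y) = ψ (-c, rad (x + c, y)) * (y / rad (x + c, y)) := by
      rw [hV, hr x y h0]
      field_simp
    rw [e, PsiL]
    split_ifs with hif
    · rw [h1 _ hρ hif]
    · rw [h2 _ (not_le.1 hif).le]

end

/-- uniqueness, up to `x₁`-translation, of positive `BUC^{2,α}` solutions of
`−Δψ + ψ = λ(ψ − W x₂)₊` in `Π` with `ψ = 0` on `∂Π` and `ψ → 0` at infinity. -/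
theorem stmt12 (lam W α : ℝ) (hlam : 1 < lam) (hW : 0 < W) (hα : 0 < α) (hα1 : α < 1)
    (ψ : ℝ × ℝ → ℝ)
    (hreg : ContDiffOn ℝ 2 ψ (closure UHP))
    (hbdd : ∀ n : ℕ, n ≤ 2 →
      ∃ M : ℝ, ∀ x ∈ closure UHP, ‖iteratedFDerivWithin ℝ n ψ (closure UHP) x‖ ≤ M)
    (hUC : ∀ n : ℕ, n ≤ 2 →
      UniformContinuousOn (iteratedFDerivWithin ℝ n ψ (closure UHP)) (closure UHP))
    (hHolder : ∃ Cα : NNReal,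
      HolderOnWith Cα ⟨α, hα.le⟩ (iteratedFDerivWithin ℝ 2 ψ (closure UHP)) (closure UHP))
    (hpos : ∀ x ∈ UHP, 0 < ψ x)
    (hpde : ∀ x ∈ UHP, -lap ψ x + ψ x = lam * max (ψ x - W * x.2) 0)
    (hbc : ∀ x₁ : ℝ, ψ (x₁, 0) = 0)
    (hdecay : ∀ ε : ℝ, 0 < ε → ∃ R : ℝ, ∀ x ∈ closure UHP, R ≤ rad x → |ψ x| ≤ ε) :
    ∃ c : ℝ, ∀ x ∈ closure UHP, ψ x = PsiL lam W (x + (c, 0)) := by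
  exact Hyp.final ⟨hlam, hW, hreg, hbdd, hUC, hpos, hpde, hbc, hdecay⟩
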